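/- arXiv:1704.08905 — 6 statements merged into one kernel-verified Lean document; each statement's English description precedes it below -/
import Mathlib

section
/- There exist L̄ ≥ L0 and a function ρ̄ : (L̄,∞) → (0,ρ0) such that for every L > L̄ and every ρ ∈ (0, ρ̄(L)) there exists a function h ∈ X_{L,ρ} which is continuous on all of ℝ and solves equation (E). -/
open Set MeasureTheory Filter

/-- The weight exponent ω. -/
noncomputable def omegaFn (m L ρ x : ℝ) : ℝ :=
  if x ≤ -(L*ρ) then m/ρ*(x+L*ρ) else if x < L*ρ then 0 else -(1/2)*(x - L*ρ)

/-- The norm on the space X_{L,ρ}. -/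
noncomputable def normX (m L ρ : ℝ) (h : ℝ → ℝ) : ℝ :=
  ⨆ x : ℝ, |h x| * Real.exp (-(omegaFn m L ρ x))

/-- Membership in the space X_{L,ρ}. -/
def memX (a m L ρ : ℝ) (h : ℝ → ℝ) : Prop :=
  ContinuousOn h {x : ℝ | x ≠ L*ρ} ∧ (∫ x : ℝ, h x) = 1 ∧
  (1/ρ) * (∫ x : ℝ, Real.exp (-(a/ρ)*x) * h x) = 1/(1+ρ) ∧
  ∀ x : ℝ, |h x| ≤ 2 * Real.exp (omegaFn m L ρ x)

/-- The hypotheses on the coagulation kernel K. -/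
def KernelHyp (K : ℝ → ℝ → ℝ) (γ a K0 δ : ℝ) : Prop :=
  γ < 1 ∧ a = 1 - γ ∧
  ContinuousOn (fun p : ℝ × ℝ => K p.1 p.2) (Ioi 0 ×ˢ Ioi 0) ∧
  (∀ x y : ℝ, 0 < x → 0 < y → 0 ≤ K x y) ∧
  (∀ x y : ℝ, 0 < x → 0 < y → K x y = K y x) ∧
  (∀ x y α : ℝ, 0 < x → 0 < y → 0 < α → K (α*x) (α*y) = α ^ γ * K x y) ∧
  0 < K0 ∧ δ ∈ Ioo 0 (min 1 a) ∧
  ∀ x ∈ Ioo (0:ℝ) 2, |x ^ a * K x 1 - 1| ≤ K0 * x ^ δ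

/-- The hypotheses on the fixed parameters m, L0, ρ0. -/
def ParamHyp (a m L0 ρ0 : ℝ) : Prop :=
  max (a+1) (3*a) < m ∧ (1/a) * Real.log (4*m) < L0 ∧ ρ0 ∈ Ioo (0:ℝ) 1

/-- The function Q[h]. -/
noncomputable def Qfun (K : ℝ → ℝ → ℝ) (a ρ : ℝ) (h : ℝ → ℝ) (y : ℝ) : ℝ :=
  ∫ z : ℝ, Real.exp (a/ρ*(y-z)) * K (Real.exp ((y-z)/ρ)) 1 * h z

/-- The function ψ_ρ[h]. -/
noncomputable def psiFn (K : ℝ → ℝ → ℝ) (a L ρ : ℝ) (h : ℝ → ℝ) (x : ℝ) : ℝ :=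
  (1/ρ) * ∫ y in Ioo x (L*ρ), Real.exp (-(a/ρ)*y) * Qfun K a ρ h y

/-- The remainder R[h]. -/
noncomputable def Rfun (K : ℝ → ℝ → ℝ) (a L ρ : ℝ) (h : ℝ → ℝ) (x : ℝ) : ℝ :=
  if x < L*ρ then
    -(1/ρ) * ∫ y in Iio x, ∫ z in Iio (x + ρ * Real.log (1 - Real.exp ((y-x)/ρ))),
      Real.exp (-(a/ρ)*z) * K (Real.exp ((y-z)/ρ)) 1 * h y * h z
  else
    -(1/ρ) * (∫ y in Ioi x, Real.exp (-(a/ρ)*y) * h y) * (∫ z in Ioi x, h z)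
    + (1/ρ) * (∫ y in Iio x, ∫ z in Ioi x,
        (Real.exp (-(a/ρ)*z) * K (Real.exp ((y-z)/ρ)) 1 - Real.exp (-(a/ρ)*y)) * h y * h z)
    + (1/ρ) * (∫ y in Iio x, ∫ z in Ioo (x + ρ * Real.log (1 - Real.exp ((y-x)/ρ))) x,
        Real.exp (-(a/ρ)*z) * K (Real.exp ((y-z)/ρ)) 1 * h y * h z)

/-- The remainder R̃[h]. -/
noncomputable def Rtil (K : ℝ → ℝ → ℝ) (a L ρ : ℝ) (h : ℝ → ℝ) (x : ℝ) : ℝ :=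
  if x < L*ρ then
    Rfun K a L ρ h x - (1/ρ) * ∫ y in Ioo x (L*ρ),
      Real.exp (-(psiFn K a L ρ h x - psiFn K a L ρ h y)) * Real.exp (-(a/ρ)*y) *
        Qfun K a ρ h y * Rfun K a L ρ h y
  else
    Rfun K a L ρ h x - (1/(1+ρ)) * ∫ y in Ioo (L*ρ) x,
      Real.exp ((y-x)/(1+ρ)) * Rfun K a L ρ h y

/-- Equation (E) in exponential variables. -/
def solvesE (K : ℝ → ℝ → ℝ) (a ρ : ℝ) (h : ℝ → ℝ) : Prop :=
  ∀ x : ℝ, h x = (1/ρ) * ∫ y in Iio x,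
    ∫ z in Ioi (x + ρ * Real.log (1 - Real.exp ((y-x)/ρ))),
      Real.exp (-(a/ρ)*z) * K (Real.exp ((y-z)/ρ)) 1 * h y * h z

/-- The decay exponent λ. -/
noncomputable def lamFn (K : ℝ → ℝ → ℝ) (a L ρ : ℝ) (h : ℝ → ℝ) (x : ℝ) : ℝ :=
  if x < L*ρ then -psiFn K a L ρ h x else -(1/2)*(x - L*ρ)

/-- The remainder H. -/
noncomputable def Hfun (K : ℝ → ℝ → ℝ) (a ρ : ℝ) (h : ℝ → ℝ) (x : ℝ) : ℝ :=
  (1/ρ) * (∫ y in Iio x, ∫ z in Ioi (x + ρ * Real.log (1 - Real.exp ((y-x)/ρ))),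
      Real.exp (-(a/ρ)*z) * K (Real.exp ((y-z)/ρ)) 1 * h y * h z)
    - (ρ/(1+ρ)) * h x - (1/(1+ρ)) * ∫ z in Ioi x, h z

namespace FPE
noncomputable def V (a x : ℝ) : ℝ := Real.exp (-(Real.exp (-(a*x))/a)/2)
noncomputable def EE (a x : ℝ) : ℝ := Real.exp (-(a*x)) * V a x
noncomputable def W (a ρ x : ℝ) : ℝ := V a x * Real.exp (-(ρ/2*max x 0))
noncomputable def kk (K : ℝ → ℝ → ℝ) (a s t : ℝ) : ℝ := Real.exp (-(a*t)) * K (Real.exp (s-t)) 1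
noncomputable def MM (K : ℝ → ℝ → ℝ) (a : ℝ) (p : ℝ × ℝ) : ℝ :=
  (if p.1 < 0 ∧ Real.log (1 - Real.exp p.1) < p.2 then kk K a p.1 p.2 else 0)
  - (if p.1 < 0 ∧ 0 < p.2 then Real.exp (-(a*p.1)) - Real.exp (-(a*p.2)) else 0)
noncomputable def Rem (K : ℝ → ℝ → ℝ) (a ρ : ℝ) (F : ℝ → ℝ → ℝ) (X : ℝ) : ℝ :=
  ρ * ∫ p : ℝ × ℝ, Real.exp (-(a*X)) * MM K a p * F (X+p.1) (X+p.2)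
noncomputable def phi (C δ t : ℝ) : ℝ :=
  C * (if 0 < t then Real.exp (-(δ*t)) else if -Real.log 2 < t then 1 else 0)
noncomputable def Maj (a C δ X : ℝ) (p : ℝ × ℝ) : ℝ :=
  (if p.1 < 0 then EE a (X+p.1) else 0) * phi C δ p.2
  + C * (if p.2 < 0 ∧ Real.log (1 - Real.exp p.2) < p.1 ∧ p.1 < 0 then
      Real.exp (p.1 - p.2) * EE a (X+p.2) else 0)

structure KH (K : ℝ → ℝ → ℝ) (a C δ : ℝ) : Prop where
  ha : 0 < a
  hδ : 0 < δ
  hδa : δ < a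
  hC : 0 < C
  cont : Continuous (fun p : ℝ × ℝ => kk K a p.1 p.2)
  h1 : ∀ s t, s ≤ t → |Real.exp (a*s) * kk K a s t - 1| ≤ (C-1) * Real.exp (δ*(s-t))
  h2 : ∀ s t, t ≤ s → |kk K a s t| ≤ C * Real.exp (s-(a+1)*t)

lemma KH_of {K : ℝ → ℝ → ℝ} {γ a K0 δ : ℝ} (hK : KernelHyp K γ a K0 δ) :
    KH K a (K0+1) δ := by
  obtain ⟨hγ, haγ, hc, hnn, hsym, hhom, hK0, ⟨hδ, hδ2⟩, hb⟩ := hK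
  have ha : 0 < a := by linarith
  have key : ∀ u : ℝ, u ≤ 0 → |Real.exp (a*u) * K (Real.exp u) 1 - 1| ≤ K0 * Real.exp (δ*u) := by
    intro u hu
    have := hb (Real.exp u) ⟨Real.exp_pos _, by
      have := Real.exp_le_one_iff.2 hu
      linarith⟩
    rw [← Real.exp_mul, ← Real.exp_mul] at this
    rwa [mul_comm a u, mul_comm δ u]
  refine ⟨ha, hδ, lt_of_lt_of_le hδ2 (min_le_right _ _), by linarith, ?_, ?_, ?_⟩
  · unfold kk
    have : Continuous (fun p : ℝ × ℝ => K (Real.exp (p.1-p.2)) 1) := by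
      have h := hc.comp_continuous (f := fun p : ℝ × ℝ => (Real.exp (p.1-p.2), (1:ℝ))) (by fun_prop)
        (fun p => ⟨Real.exp_pos _, by simp⟩)
      exact h
    exact (Real.continuous_exp.comp (by fun_prop)).mul this
  · intro s t hst
    have := key (s-t) (by linarith)
    have e : Real.exp (a*s) * kk K a s t = Real.exp (a*(s-t)) * K (Real.exp (s-t)) 1 := by
      unfold kk
      rw [← mul_assoc, ← Real.exp_add]; ring_nf
    rw [e]; simpa using this
  · intro s t hst
    have := key (t-s) (by linarith)
    have hx := abs_le.1 this
    have h1 : Real.exp (δ*(t-s)) ≤ 1 := Real.exp_le_one_iff.2 (by nlinarith)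
    have h2 : Real.exp (a*(t-s)) * K (Real.exp (t-s)) 1 ≤ K0 + 1 := by nlinarith
    have h3 : K (Real.exp (s-t)) 1 = Real.exp (γ*(s-t)) * K (Real.exp (t-s)) 1 := by
      have := hhom 1 (Real.exp (t-s)) (Real.exp (s-t)) one_pos (Real.exp_pos _) (Real.exp_pos _)
      rw [← Real.exp_add, ← Real.exp_mul, hsym 1 _ one_pos (Real.exp_pos _)] at this
      rw [show s - t + (t-s) = 0 by ring, Real.exp_zero, mul_one] at this
      rw [this, mul_comm γ]
    have h0 : 0 ≤ kk K a s t := mul_nonneg (Real.exp_pos _).le (hnn _ _ (Real.exp_pos _) one_pos)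
    rw [abs_of_nonneg h0]
    unfold kk
    rw [h3]
    have e : Real.exp (-(a*t)) * (Real.exp (γ*(s-t)) * K (Real.exp (t-s)) 1)
        = Real.exp (s-(a+1)*t) * (Real.exp (a*(t-s)) * K (Real.exp (t-s)) 1) := by
      rw [← mul_assoc, ← mul_assoc, ← Real.exp_add, ← Real.exp_add]
      congr 2
      rw [haγ]; ring
    rw [e, mul_comm]
    exact mul_le_mul_of_nonneg_right h2 (Real.exp_pos _).le

lemma V_pos (a x : ℝ) : 0 < V a x := Real.exp_pos _
lemma EE_pos (a x : ℝ) : 0 < EE a x := mul_pos (Real.exp_pos _) (V_pos _ _)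
lemma W_pos (a ρ x : ℝ) : 0 < W a ρ x := mul_pos (V_pos _ _) (Real.exp_pos _)
lemma V_le_one {a : ℝ} (ha : 0 < a) (x : ℝ) : V a x ≤ 1 := by
  apply Real.exp_le_one_iff.2
  have := Real.exp_pos (-(a*x))
  have : 0 < Real.exp (-(a*x))/a := by positivity
  linarith
lemma V_mono {a : ℝ} (ha : 0 < a) : Monotone (V a) := by
  intro x y h
  apply Real.exp_le_exp.2
  have : Real.exp (-(a*y)) ≤ Real.exp (-(a*x)) := Real.exp_le_exp.2 (by nlinarith)
  have : Real.exp (-(a*y))/a ≤ Real.exp (-(a*x))/a := by gcongr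
  linarith
lemma W_le_V {a ρ : ℝ} (hρ : 0 < ρ) (x : ℝ) : W a ρ x ≤ V a x := by
  unfold W
  apply mul_le_of_le_one_right (V_pos _ _).le
  apply Real.exp_le_one_iff.2
  have := le_max_right x 0
  have : 0 ≤ ρ/2*max x 0 := by positivity
  linarith
lemma W_le_exp {a ρ : ℝ} (ha : 0 < a) (x : ℝ) : W a ρ x ≤ Real.exp (-(ρ/2*max x 0)) := by
  unfold W
  exact mul_le_of_le_one_left (Real.exp_pos _).le (V_le_one ha x)
lemma V_cont (a : ℝ) : Continuous (V a) := by unfold V; fun_prop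
lemma EE_cont (a : ℝ) : Continuous (EE a) := by
  have := V_cont a
  unfold EE; fun_prop
lemma W_cont (a ρ : ℝ) : Continuous (W a ρ) := by
  have := V_cont a
  unfold W; fun_prop

lemma V_deriv {a : ℝ} (ha : 0 < a) (x : ℝ) : HasDerivAt (fun x => 2 * V a x) (EE a x) x := by
  unfold V EE V
  have h1 : HasDerivAt (fun x : ℝ => -(a*x)) (-a) x := by
    simpa using ((hasDerivAt_id' x).const_mul a).fun_neg
  have := (((h1.exp.div_const a).fun_neg.div_const 2).exp.const_mul 2)
  refine this.congr_deriv ?_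
  field_simp

lemma V_tendsto_bot {a : ℝ} (ha : 0 < a) : Tendsto (V a) atBot (nhds 0) := by
  unfold V
  apply Real.tendsto_exp_atBot.comp
  have h1 : Tendsto (fun x : ℝ => Real.exp (-(a*x))) atBot atTop := by
    apply Real.tendsto_exp_atTop.comp
    apply tendsto_neg_atBot_atTop.comp
    exact tendsto_id.const_mul_atBot ha
  have h2 := (h1.atTop_div_const ha)
  have h3 := tendsto_neg_atTop_atBot.comp h2
  exact h3.atBot_div_const (by norm_num)

lemma V_tendsto_top {a : ℝ} (ha : 0 < a) : Tendsto (V a) atTop (nhds 1) := by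
  unfold V
  have h1 : Tendsto (fun x : ℝ => Real.exp (-(a*x))) atTop (nhds 0) := by
    apply Real.tendsto_exp_atBot.comp
    apply tendsto_neg_atTop_atBot.comp
    exact tendsto_id.const_mul_atTop ha
  have := (Real.continuous_exp.tendsto _).comp ((h1.div_const a).neg.div_const 2)
  simpa [Function.comp_def] using this

lemma EE_int {a : ℝ} (ha : 0 < a) : Integrable (EE a) := by
  have hb : Tendsto (fun x => 2 * V a x) atBot (nhds 0) := by
    simpa using (V_tendsto_bot ha).const_mul 2
  have ht : Tendsto (fun x => 2 * V a x) atTop (nhds 2) := by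
    simpa using (V_tendsto_top ha).const_mul 2
  rw [← integrableOn_univ, ← Iic_union_Ioi (a := (0:ℝ))]
  apply IntegrableOn.union
  · have h1 : IntegrableOn (fun x => EE a (-x)) (Ioi 0) := by
      refine integrableOn_Ioi_deriv_of_nonneg' (g := fun x => -(2 * V a (-x))) (l := -0) (fun x _ => ?_)
        (fun x _ => (EE_pos a _).le) (hb.comp tendsto_neg_atTop_atBot).neg
      have := ((V_deriv ha (-x)).comp x (hasDerivAt_neg x)).neg
      refine this.congr_deriv ?_
      simp
    have h2 := (integrableOn_Ici_iff_integrableOn_Ioi).2 h1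
    have h3 := (Measure.measurePreserving_neg (volume : Measure ℝ)).integrableOn_comp_preimage
      (Homeomorph.neg ℝ).measurableEmbedding (f := EE a) (s := Iic 0)
    apply h3.1
    simpa [Function.comp_def] using h2
  · exact integrableOn_Ioi_deriv_of_nonneg' (fun x _ => V_deriv ha x) (fun x _ => (EE_pos a x).le) ht

lemma EE_Iic {a : ℝ} (ha : 0 < a) (x : ℝ) : ∫ y in Iic x, EE a y = 2 * V a x := by
  have hb : Tendsto (fun x => 2 * V a x) atBot (nhds 0) := by
    simpa using (V_tendsto_bot ha).const_mul 2
  have := integral_Iic_of_hasDerivAt_of_tendsto' (fun x _ => V_deriv ha x) (EE_int ha).integrableOn hb (a := x)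
  simpa using this

lemma EE_shift_int {a : ℝ} (ha : 0 < a) (X : ℝ) :
    Integrable (fun s => if s < 0 then EE a (X+s) else 0) := by
  have h := ((EE_int ha).comp_add_left X).indicator (measurableSet_Iio (a := (0:ℝ)))
  exact h

lemma EE_shift {a : ℝ} (ha : 0 < a) (X : ℝ) :
    ∫ s : ℝ, (if s < 0 then EE a (X+s) else 0) = 2 * V a X := by
  rw [← EE_Iic ha X, integral_Iic_eq_integral_Iio, ← integral_indicator measurableSet_Iio]
  rw [← integral_add_left_eq_self ((Iio X).indicator (EE a)) X]
  congr 1; ext s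
  simp [indicator]
end FPE

namespace FPE
lemma phi_int {C δ : ℝ} (hδ : 0 < δ) : Integrable (phi C δ) := by
  unfold phi
  apply Integrable.const_mul
  have h1 : Integrable ((Ioi (0:ℝ)).indicator (fun t => Real.exp (-δ*t))) :=
    (exp_neg_integrableOn_Ioi 0 hδ).integrable_indicator measurableSet_Ioi
  have h2 : Integrable ((Ioc (-Real.log 2) 0).indicator (fun _ => (1:ℝ))) :=
    IntegrableOn.integrable_indicator (by simp) measurableSet_Ioc
  refine (h1.add h2).congr (Eventually.of_forall fun t => ?_)
  simp only [Pi.add_apply, indicator, mem_Ioi, mem_Ioc, neg_mul]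
  by_cases ht : 0 < t
  · simp [ht, not_le.2 ht]
  · simp [ht, not_lt.1 ht]

lemma phi_nonneg {C δ : ℝ} (hC : 0 < C) (t : ℝ) : 0 ≤ phi C δ t := by
  unfold phi
  split_ifs <;> positivity

noncomputable def SS (a X : ℝ) (p : ℝ × ℝ) : ℝ :=
  if p.2 < 0 ∧ Real.log (1 - Real.exp p.2) < p.1 ∧ p.1 < 0 then
      Real.exp (p.1 - p.2) * EE a (X+p.2) else 0

lemma SS_nonneg (a X : ℝ) (p) : 0 ≤ SS a X p := by
  unfold SS
  have := EE_pos a (X+p.2)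
  split_ifs <;> positivity

lemma SS_meas (a X : ℝ) : Measurable (SS a X) := by
  unfold SS
  have := (EE_cont a).measurable
  apply Measurable.ite
  · refine MeasurableSet.inter (s₁ := {p : ℝ × ℝ | p.2 < 0}) (measurableSet_lt (by fun_prop) (by fun_prop)) ?_
    refine MeasurableSet.inter (s₁ := {p : ℝ × ℝ | Real.log (1 - Real.exp p.2) < p.1})
      (s₂ := {p : ℝ × ℝ | p.1 < 0}) (measurableSet_lt ?_ (by fun_prop)) (measurableSet_lt (by fun_prop) (by fun_prop))
    exact Real.measurable_log.comp (by fun_prop)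
  · fun_prop
  · fun_prop

lemma SS_slice (a X t : ℝ) : (fun s => SS a X (s,t)) =
    (Ioo (Real.log (1 - Real.exp t)) 0).indicator
      (fun s => Real.exp s * (Real.exp (-t) * (if t < 0 then EE a (X+t) else 0))) := by
  ext s
  simp only [SS, indicator, mem_Ioo]
  by_cases ht : t < 0
  · simp only [ht, true_and, if_true]
    split_ifs
    · rw [sub_eq_add_neg, Real.exp_add]; ring
    · rfl
  · simp [ht]

lemma SS_slice_integrable (a X t : ℝ) : Integrable (fun s => SS a X (s,t)) := by
  rw [SS_slice]
  apply IntegrableOn.integrable_indicator _ measurableSet_Ioo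
  apply IntegrableOn.mono_set _ Ioo_subset_Icc_self
  exact (Continuous.continuousOn (by fun_prop)).integrableOn_Icc

lemma SS_slice_integral (a X t : ℝ) : ∫ s, SS a X (s,t) = if t < 0 then EE a (X+t) else 0 := by
  rw [SS_slice, integral_indicator measurableSet_Ioo]
  by_cases ht : t < 0
  · simp only [ht, if_true]
    have h1 : 0 < 1 - Real.exp t := by
      have := Real.exp_lt_one_iff.2 ht; linarith
    rw [← integral_Ioc_eq_integral_Ioo, ← intervalIntegral.integral_of_le, intervalIntegral.integral_mul_const,
      integral_exp, Real.exp_log h1, Real.exp_neg, Real.exp_zero]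
    · have := Real.exp_pos t
      field_simp
      ring
    · apply Real.log_nonpos h1.le
      have := Real.exp_pos t
      linarith
  · simp [ht]

lemma SS_int {a : ℝ} (ha : 0 < a) (X : ℝ) : Integrable (SS a X) := by
  rw [Measure.volume_eq_prod, integrable_prod_iff' (SS_meas a X).aestronglyMeasurable]
  refine ⟨Eventually.of_forall fun t => SS_slice_integrable a X t, ?_⟩
  simp_rw [Real.norm_of_nonneg (SS_nonneg a X _), SS_slice_integral]
  exact EE_shift_int ha X

lemma SS_integral {a : ℝ} (ha : 0 < a) (X : ℝ) : ∫ p, SS a X p = 2 * V a X := by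
  rw [Measure.volume_eq_prod, integral_prod_symm _ (SS_int ha X)]
  simp_rw [SS_slice_integral]
  exact EE_shift ha X

lemma Maj_eq (a C δ X : ℝ) : Maj a C δ X = fun p =>
  (if p.1 < 0 then EE a (X+p.1) else 0) * phi C δ p.2 + C * SS a X p := rfl

lemma Maj_int {a C δ : ℝ} (ha : 0 < a) (hδ : 0 < δ) (X : ℝ) : Integrable (Maj a C δ X) := by
  rw [Maj_eq]
  exact ((EE_shift_int ha X).mul_prod (phi_int hδ)).add ((SS_int ha X).const_mul C)

noncomputable def C2 (C δ : ℝ) : ℝ := 2 * (∫ t, phi C δ t) + 2 * C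

lemma C2_pos {C δ : ℝ} (hC : 0 < C) : 0 < C2 C δ := by
  have : 0 ≤ ∫ t, phi C δ t := integral_nonneg (phi_nonneg hC)
  unfold C2; positivity

lemma Maj_integral {a C δ : ℝ} (ha : 0 < a) (hδ : 0 < δ) (X : ℝ) :
    ∫ p, Maj a C δ X p = C2 C δ * V a X := by
  rw [Maj_eq, integral_add, integral_const_mul, SS_integral ha, Measure.volume_eq_prod,
    integral_prod_mul (fun s => if s < 0 then EE a (X+s) else 0) (phi C δ), EE_shift ha, C2]
  · ring
  · exact ((EE_shift_int ha X).mul_prod (phi_int hδ))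
  · exact ((SS_int ha X).const_mul C)

lemma Maj_nonneg {a C δ : ℝ} (hC : 0 < C) (X : ℝ) (p) : 0 ≤ Maj a C δ X p := by
  rw [Maj_eq]
  have := SS_nonneg a X p
  have := phi_nonneg (δ := δ) hC p.2
  have := EE_pos a (X+p.1)
  have : 0 ≤ (if p.1 < 0 then EE a (X+p.1) else 0) := by split_ifs <;> positivity
  positivity

lemma EE_mono {a : ℝ} (ha : 0 < a) {x y : ℝ} (h : x ≤ y) : EE a x ≤ Real.exp (a*(y-x)) * EE a y := by
  unfold EE
  rw [← mul_assoc, ← Real.exp_add, show a*(y-x) + -(a*y) = -(a*x) by ring]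
  exact mul_le_mul_of_nonneg_left (V_mono ha h) (Real.exp_pos _).le

lemma Maj_mono {a C δ : ℝ} (ha : 0 < a) (hC : 0 < C) {X Y : ℝ} (h : X ≤ Y) (p) :
    Maj a C δ X p ≤ Real.exp (a*(Y-X)) * Maj a C δ Y p := by
  simp only [Maj_eq, SS]
  have h1 := EE_mono ha (x := X+p.1) (y := Y+p.1) (by linarith)
  have h2 := EE_mono ha (x := X+p.2) (y := Y+p.2) (by linarith)
  rw [show Y + p.1 - (X+p.1) = Y - X by ring] at h1
  rw [show Y + p.2 - (X+p.2) = Y - X by ring] at h2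
  have := phi_nonneg (δ := δ) hC p.2
  have e1 : (if p.1 < 0 then EE a (X+p.1) else 0) ≤ Real.exp (a*(Y-X)) * (if p.1 < 0 then EE a (Y+p.1) else 0) := by
    split_ifs
    · exact h1
    · simp
  have e2 : (if p.2 < 0 ∧ Real.log (1 - Real.exp p.2) < p.1 ∧ p.1 < 0 then
      Real.exp (p.1 - p.2) * EE a (X+p.2) else 0) ≤ Real.exp (a*(Y-X)) * (if p.2 < 0 ∧ Real.log (1 - Real.exp p.2) < p.1 ∧ p.1 < 0 then
      Real.exp (p.1 - p.2) * EE a (Y+p.2) else 0) := by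
    split_ifs
    · have := mul_le_mul_of_nonneg_left h2 (Real.exp_pos (p.1-p.2)).le
      linarith
    · simp
  have e3 := mul_le_mul_of_nonneg_right e1 this
  have e4 := mul_le_mul_of_nonneg_left e2 hC.le
  linarith

lemma W_shift {a ρ : ℝ} (ha : 0 < a) (hρ : 0 < ρ) (hρ1 : ρ ≤ 1) {X t : ℝ} (ht : -Real.log 2 < t) :
    W a ρ (X+t) ≤ 2 * Real.exp (-(ρ/2*max X 0)) := by
  refine (W_le_exp ha _).trans ?_
  rw [← Real.exp_log (show (0:ℝ) < 2 by norm_num), ← Real.exp_add, Real.exp_log (by norm_num)]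
  apply Real.exp_le_exp.2
  have l2 : 0 < Real.log 2 := Real.log_pos (by norm_num)
  have : max X 0 ≤ max (X+t) 0 + Real.log 2 := by
    apply max_le
    · have := le_max_left (X+t) 0; linarith
    · have := le_max_right (X+t) 0; linarith
  nlinarith

lemma M_bound {K : ℝ → ℝ → ℝ} {a C δ ρ : ℝ} (H : KH K a C δ) (hρ : 0 < ρ) (hρ1 : ρ ≤ 1) (X : ℝ)
    (p : ℝ × ℝ) :
    Real.exp (-(a*X)) * |MM K a p| * (W a ρ (X+p.1) * W a ρ (X+p.2)) ≤
      2 * Real.exp (-(ρ/2*max X 0)) * Maj a C δ X p := by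
  obtain ⟨s, t⟩ := p
  have hC := H.hC
  have ha := H.ha
  have hδ := H.hδ
  have hM := Maj_nonneg (a := a) (δ := δ) hC X (s,t)
  have hrhs : 0 ≤ 2 * Real.exp (-(ρ/2*max X 0)) * Maj a C δ X (s,t) := by positivity
  have l2 : 0 < Real.log 2 := Real.log_pos (by norm_num)
  by_cases hs : s < 0
  swap
  · simpa [MM, hs] using hrhs
  have hes : Real.exp s < 1 := Real.exp_lt_one_iff.2 hs
  have hes0 := Real.exp_pos s
  -- reduction for the first term
  have red1 : ∀ r, |MM K a (s,t)| ≤ r * Real.exp (-(a*s)) → r ≤ phi C δ t → 0 ≤ r → -Real.log 2 < t →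
      Real.exp (-(a*X)) * |MM K a (s,t)| * (W a ρ (X+s) * W a ρ (X+t)) ≤
      2 * Real.exp (-(ρ/2*max X 0)) * Maj a C δ X (s,t) := by
    intro r h1 h2 h0 h3
    calc Real.exp (-(a*X)) * |MM K a (s,t)| * (W a ρ (X+s) * W a ρ (X+t))
        ≤ Real.exp (-(a*X)) * (phi C δ t * Real.exp (-(a*s))) * (V a (X+s) * (2 * Real.exp (-(ρ/2*max X 0)))) := by
          have p1 := (W_pos a ρ (X+s)).le
          have p2 := (W_pos a ρ (X+t)).le
          have p3 := (V_pos a (X+s)).le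
          have p4 := W_le_V (a := a) hρ (X+s)
          have p5 := W_shift ha hρ hρ1 (X := X) h3
          have p6 := h1.trans (mul_le_mul_of_nonneg_right h2 (Real.exp_pos (-(a*s))).le)
          have p7 := phi_nonneg (δ := δ) hC t
          gcongr
      _ = 2 * Real.exp (-(ρ/2*max X 0)) * (EE a (X+s) * phi C δ t) := by
          unfold EE
          rw [show -(a*(X+s)) = -(a*X) + -(a*s) by ring, Real.exp_add]; ring
      _ ≤ _ := by
          rw [Maj_eq]
          have := SS_nonneg a X (s,t)
          simp only [hs, if_true]
          apply mul_le_mul_of_nonneg_left _ (by positivity)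
          have : 0 ≤ C * SS a X (s,t) := by positivity
          linarith
  by_cases ht : 0 < t
  · have hlog : Real.log (1 - Real.exp s) < t :=
      lt_of_le_of_lt (Real.log_nonpos (by linarith) (by linarith)) ht
    have hMM : MM K a (s,t) = kk K a s t - (Real.exp (-(a*s)) - Real.exp (-(a*t))) := by
      simp [MM, hs, ht, hlog]
    apply red1 (C * Real.exp (δ*(s-t)))
    · have := H.h1 s t (by linarith)
      have e : MM K a (s,t) = Real.exp (-(a*s)) * ((Real.exp (a*s) * kk K a s t - 1) + Real.exp (a*(s-t))) := by
        rw [hMM]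
        have e1 : Real.exp (-(a*s)) * Real.exp (a*s) = 1 := by rw [← Real.exp_add]; simp
        have e2 : Real.exp (-(a*s)) * Real.exp (a*(s-t)) = Real.exp (-(a*t)) := by
          rw [← Real.exp_add]; ring_nf
        linear_combination (-kk K a s t) * e1 - e2
      rw [e, abs_mul, abs_of_pos (Real.exp_pos _), mul_comm]
      apply mul_le_mul_of_nonneg_right _ (Real.exp_pos _).le
      refine (abs_add_le _ _).trans ?_
      rw [abs_of_pos (Real.exp_pos (a*(s-t)))]
      have : Real.exp (a*(s-t)) ≤ Real.exp (δ*(s-t)) := Real.exp_le_exp.2 (by nlinarith [H.hδa])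
      linarith
    · simp only [phi, ht, if_true]
      gcongr
      nlinarith
    · positivity
    · linarith
  · have ht' := not_lt.1 ht
    by_cases hlog : Real.log (1 - Real.exp s) < t
    swap
    · simpa [MM, hs, ht, hlog] using hrhs
    have hMM : MM K a (s,t) = kk K a s t := by
      simp [MM, hs, ht, hlog]
    have hsum : 1 < Real.exp s + Real.exp t := by
      have := (Real.log_lt_iff_lt_exp (by linarith)).1 hlog
      linarith
    have hl2 : ∀ x, 1/2 < Real.exp x → -Real.log 2 < x := by
      intro x hx
      rw [← Real.log_inv, Real.log_lt_iff_lt_exp (by norm_num)]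
      norm_num at hx ⊢; exact hx
    by_cases hst : s ≤ t
    · have hlt : -Real.log 2 < t := by
        apply hl2
        have := Real.exp_le_exp.2 hst; linarith
      apply red1 C _ _ hC.le hlt
      · rw [hMM]
        have h1 := H.h1 s t hst
        have e : kk K a s t = Real.exp (-(a*s)) * (Real.exp (a*s) * kk K a s t) := by
          rw [← mul_assoc, ← Real.exp_add]; simp
        rw [e, abs_mul, abs_of_pos (Real.exp_pos _), mul_comm]
        apply mul_le_mul_of_nonneg_right _ (Real.exp_pos _).le
        have h2 : |Real.exp (a*s) * kk K a s t| ≤ |Real.exp (a*s) * kk K a s t - 1| + |1| := by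
          have := abs_add_le (Real.exp (a*s) * kk K a s t - 1) 1
          simpa using this
        have h3 : Real.exp (δ*(s-t)) ≤ 1 := Real.exp_le_one_iff.2 (by nlinarith)
        have h0 : 0 ≤ C - 1 := by
          have := (abs_nonneg _).trans (H.h1 0 0 le_rfl)
          simpa using this
        rw [abs_one] at h2
        nlinarith
      · simp [phi, ht, hlt]
    · have hst' := not_le.1 hst
      have hlt : -Real.log 2 < s := by
        apply hl2
        have := Real.exp_lt_exp.2 hst'; linarith
      have ht0 : t < 0 := by linarith
      have hlog2 : Real.log (1 - Real.exp t) < s := by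
        rw [Real.log_lt_iff_lt_exp]
        · linarith
        · have := Real.exp_lt_one_iff.2 ht0; linarith
      calc
        Real.exp (-(a*X)) * |MM K a (s,t)| * (W a ρ (X+s) * W a ρ (X+t))
          ≤ Real.exp (-(a*X)) * (C * Real.exp (s-(a+1)*t)) * ((2 * Real.exp (-(ρ/2*max X 0))) * V a (X+t)) := by
          have p1 := (W_pos a ρ (X+s)).le
          have p2 := (W_pos a ρ (X+t)).le
          have p3 := (V_pos a (X+s)).le
          have p4 := W_le_V (a := a) hρ (X+t)
          have p5 := W_shift ha hρ hρ1 (X := X) hlt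
          have p6 := H.h2 s t hst'.le
          rw [← hMM] at p6
          gcongr
        _ = 2 * Real.exp (-(ρ/2*max X 0)) * (C * SS a X (s,t)) := by
          simp only [SS, ht0, hlog2, hs, true_and, if_true]
          unfold EE
          rw [show s-(a+1)*t = (s-t) + -(a*t) by ring, show -(a*(X+t)) = -(a*X) + -(a*t) by ring, Real.exp_add, Real.exp_add (-(a*X))]; ring
        _ ≤ _ := by
          rw [Maj_eq]
          have h1 := phi_nonneg (δ := δ) hC t
          have h2 := EE_pos a (X+s)
          simp only [hs, if_true]
          apply mul_le_mul_of_nonneg_left _ (by positivity)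
          have : 0 ≤ EE a (X+s) * phi C δ t := by positivity
          linarith
end FPE

namespace FPE
lemma MM_meas {K : ℝ → ℝ → ℝ} {a C δ : ℝ} (H : KH K a C δ) : Measurable (MM K a) := by
  have := H.cont.measurable
  unfold MM
  apply Measurable.sub
  · apply Measurable.ite _ this measurable_const
    refine MeasurableSet.inter (s₁ := {p : ℝ × ℝ | p.1 < 0})
      (s₂ := {p : ℝ × ℝ | Real.log (1 - Real.exp p.1) < p.2}) (measurableSet_lt (by fun_prop) (by fun_prop))
      (measurableSet_lt ?_ (by fun_prop))
    exact Real.measurable_log.comp (by fun_prop)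
  · apply Measurable.ite _ (by fun_prop) measurable_const
    exact MeasurableSet.inter (s₁ := {p : ℝ × ℝ | p.1 < 0})
      (s₂ := {p : ℝ × ℝ | 0 < p.2}) (measurableSet_lt (by fun_prop) (by fun_prop))
      (measurableSet_lt (by fun_prop) (by fun_prop))

lemma Rem_pt {K : ℝ → ℝ → ℝ} {a C δ ρ b : ℝ} (H : KH K a C δ) (hρ : 0 < ρ) (hρ1 : ρ ≤ 1)
    (hb : 0 ≤ b) {F : ℝ → ℝ → ℝ} (hF : ∀ y z, |F y z| ≤ b * (W a ρ y * W a ρ z)) (X : ℝ) (p : ℝ × ℝ) :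
    ‖Real.exp (-(a*X)) * MM K a p * F (X+p.1) (X+p.2)‖ ≤
      b * (2 * Real.exp (-(ρ/2*max X 0)) * Maj a C δ X p) := by
  rw [norm_mul, norm_mul, Real.norm_eq_abs, Real.norm_eq_abs, Real.norm_eq_abs, abs_of_pos (Real.exp_pos _)]
  have h1 := mul_le_mul_of_nonneg_left (hF (X+p.1) (X+p.2))
    (mul_nonneg (Real.exp_pos (-(a*X))).le (abs_nonneg (MM K a p)))
  have h2 := mul_le_mul_of_nonneg_left (M_bound H hρ hρ1 X p) hb
  linarith

lemma Rem_meas {K : ℝ → ℝ → ℝ} {a C δ : ℝ} (H : KH K a C δ)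
    {F : ℝ → ℝ → ℝ} (hc : Continuous (Function.uncurry F)) (X : ℝ) :
    AEStronglyMeasurable (fun p : ℝ × ℝ => Real.exp (-(a*X)) * MM K a p * F (X+p.1) (X+p.2)) volume := by
  have h1 := MM_meas H
  have h2 : Measurable (fun p : ℝ × ℝ => F (X+p.1) (X+p.2)) :=
    (hc.comp (f := fun p : ℝ × ℝ => (X+p.1, X+p.2)) (by fun_prop)).measurable
  exact ((h1.const_mul _).mul h2).aestronglyMeasurable

lemma Rem_integrable {K : ℝ → ℝ → ℝ} {a C δ ρ b : ℝ} (H : KH K a C δ) (hρ : 0 < ρ) (hρ1 : ρ ≤ 1)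
    (hb : 0 ≤ b) {F : ℝ → ℝ → ℝ} (hc : Continuous (Function.uncurry F))
    (hF : ∀ y z, |F y z| ≤ b * (W a ρ y * W a ρ z)) (X : ℝ) :
    Integrable (fun p : ℝ × ℝ => Real.exp (-(a*X)) * MM K a p * F (X+p.1) (X+p.2)) :=
  Integrable.mono' (((Maj_int H.ha H.hδ X).const_mul _).const_mul b) (Rem_meas H hc X)
    (Eventually.of_forall (Rem_pt H hρ hρ1 hb hF X))

lemma Rem_bound {K : ℝ → ℝ → ℝ} {a C δ ρ b : ℝ} (H : KH K a C δ) (hρ : 0 < ρ) (hρ1 : ρ ≤ 1)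
    (hb : 0 ≤ b) {F : ℝ → ℝ → ℝ}
    (hF : ∀ y z, |F y z| ≤ b * (W a ρ y * W a ρ z)) (X : ℝ) :
    |Rem K a ρ F X| ≤ ρ * (b * (2 * C2 C δ)) * W a ρ X := by
  unfold Rem
  rw [abs_mul, abs_of_pos hρ, mul_assoc ρ]
  apply mul_le_mul_of_nonneg_left _ hρ.le
  have := norm_integral_le_of_norm_le (((Maj_int (C := C) H.ha H.hδ X).const_mul _).const_mul b)
    (Eventually.of_forall (Rem_pt H hρ hρ1 hb hF X))
  rw [Real.norm_eq_abs, integral_const_mul, integral_const_mul, Maj_integral H.ha H.hδ] at this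
  refine this.trans (le_of_eq ?_)
  unfold W; ring

lemma Rem_cont {K : ℝ → ℝ → ℝ} {a C δ ρ b : ℝ} (H : KH K a C δ) (hρ : 0 < ρ) (hρ1 : ρ ≤ 1)
    (hb : 0 ≤ b) {F : ℝ → ℝ → ℝ} (hc : Continuous (Function.uncurry F))
    (hF : ∀ y z, |F y z| ≤ b * (W a ρ y * W a ρ z)) : Continuous (Rem K a ρ F) := by
  unfold Rem
  apply Continuous.mul continuous_const
  rw [continuous_iff_continuousAt]
  intro X0
  apply continuousAt_of_dominated (bound := fun p => b * (2 * (Real.exp (a*2) * Maj a C δ (X0+1) p)))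
  · exact Eventually.of_forall fun X => Rem_meas H hc X
  · have : ∀ᶠ X in nhds X0, X ∈ Ioo (X0-1) (X0+1) := Ioo_mem_nhds (by linarith) (by linarith)
    filter_upwards [this] with X hX
    refine Eventually.of_forall fun p => (Rem_pt H hρ hρ1 hb hF X p).trans ?_
    have ha := H.ha
    have h1 := Maj_mono (δ := δ) ha H.hC hX.2.le p
    have h2 := Maj_nonneg (a := a) (δ := δ) H.hC X p
    have h3 := Maj_nonneg (a := a) (δ := δ) H.hC (X0+1) p
    have h4 : Real.exp (a*(X0+1-X)) ≤ Real.exp (a*2) := Real.exp_le_exp.2 (by nlinarith [hX.1])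
    have h5 : Real.exp (-(ρ/2*max X 0)) ≤ 1 := by
      apply Real.exp_le_one_iff.2
      have := le_max_right X 0
      have : 0 ≤ ρ/2*max X 0 := by positivity
      linarith
    apply mul_le_mul_of_nonneg_left _ hb
    rw [mul_assoc]
    apply mul_le_mul_of_nonneg_left _ (by norm_num)
    calc _ ≤ 1 * Maj a C δ X p := by gcongr
      _ ≤ _ := by rw [one_mul]; exact h1.trans (mul_le_mul_of_nonneg_right h4 h3)
  · exact ((((Maj_int H.ha H.hδ _).const_mul _).const_mul _).const_mul _)
  · refine Eventually.of_forall fun p => Continuous.continuousAt ?_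
    have : Continuous (fun X : ℝ => F (X+p.1) (X+p.2)) :=
      hc.comp (f := fun X : ℝ => (X+p.1, X+p.2)) (by fun_prop)
    fun_prop

lemma Rem_sub {K : ℝ → ℝ → ℝ} {a C δ ρ b b' : ℝ} (H : KH K a C δ) (hρ : 0 < ρ) (hρ1 : ρ ≤ 1)
    (hb : 0 ≤ b) (hb' : 0 ≤ b') {F F' : ℝ → ℝ → ℝ} (hc : Continuous (Function.uncurry F))
    (hc' : Continuous (Function.uncurry F'))
    (hF : ∀ y z, |F y z| ≤ b * (W a ρ y * W a ρ z)) (hF' : ∀ y z, |F' y z| ≤ b' * (W a ρ y * W a ρ z)) (X : ℝ) :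
    Rem K a ρ F X - Rem K a ρ F' X = Rem K a ρ (fun y z => F y z - F' y z) X := by
  unfold Rem
  rw [← mul_sub, ← integral_sub (Rem_integrable H hρ hρ1 hb hc hF X) (Rem_integrable H hρ hρ1 hb' hc' hF' X)]
  congr 2; ext p; ring

noncomputable def G0 (a ρ x : ℝ) : ℝ := Real.exp (-(Real.exp (-(a*x))/a) - ρ/(1+ρ)*x)
noncomputable def be (a ρ x : ℝ) : ℝ := Real.exp (-(a*x)) - ρ/(1+ρ)
noncomputable def NN (a ρ : ℝ) (f : ℝ → ℝ) (X : ℝ) : ℝ :=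
  f X + G0 a ρ X * ∫ y in (0:ℝ)..X, be a ρ y * f y / G0 a ρ y

lemma G0_pos (a ρ x : ℝ) : 0 < G0 a ρ x := Real.exp_pos _
lemma G0_cont (a ρ : ℝ) : Continuous (G0 a ρ) := by unfold G0; fun_prop
lemma be_cont (a ρ : ℝ) : Continuous (be a ρ) := by unfold be; fun_prop
lemma q_cont {a ρ : ℝ} {f : ℝ → ℝ} (hf : Continuous f) : Continuous (fun y => be a ρ y * f y / G0 a ρ y) :=
  ((be_cont a ρ).mul hf).div (G0_cont a ρ) (fun x => (G0_pos a ρ x).ne')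
lemma G0_deriv {a : ℝ} (ha : 0 < a) (ρ x : ℝ) : HasDerivAt (G0 a ρ) (be a ρ x * G0 a ρ x) x := by
  have h1 : HasDerivAt (fun x : ℝ => -(a*x)) (-a) x := by
    simpa using ((hasDerivAt_id' x).const_mul a).fun_neg
  have := ((h1.exp.div_const a).fun_neg.fun_sub ((hasDerivAt_id' x).const_mul (ρ/(1+ρ)))).exp
  refine this.congr_deriv ?_
  unfold be G0
  field_simp

lemma v_deriv {a : ℝ} (ha : 0 < a) (ρ c x : ℝ) {f : ℝ → ℝ} (hf : Continuous f) :
    HasDerivAt (fun X => G0 a ρ X * (c + ∫ y in (0:ℝ)..X, be a ρ y * f y / G0 a ρ y))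
      (be a ρ x * (G0 a ρ x * (c + ∫ y in (0:ℝ)..x, be a ρ y * f y / G0 a ρ y) + f x)) x := by
  have h2 := ((q_cont (a := a) (ρ := ρ) hf).integral_hasStrictDerivAt 0 x).hasDerivAt
  have := (G0_deriv ha ρ x).fun_mul (h2.const_add c)
  refine this.congr_deriv ?_
  have := (G0_pos a ρ x).ne'
  field_simp

lemma NN_cont {a : ℝ} (ha : 0 < a) (ρ : ℝ) {f : ℝ → ℝ} (hf : Continuous f) : Continuous (NN a ρ f) := by
  have h : Continuous (fun X => G0 a ρ X * (0 + ∫ y in (0:ℝ)..X, be a ρ y * f y / G0 a ρ y)) :=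
    continuous_iff_continuousAt.2 fun x => (v_deriv ha ρ 0 x hf).continuousAt
  simp only [zero_add] at h
  exact hf.add h

lemma NN_sub {a : ℝ} (ρ : ℝ) {f g : ℝ → ℝ} (hf : Continuous f) (hg : Continuous g) (X : ℝ) :
    NN a ρ f X - NN a ρ g X = NN a ρ (fun x => f x - g x) X := by
  unfold NN
  have : ∫ y in (0:ℝ)..X, be a ρ y * (f y - g y) / G0 a ρ y = (∫ y in (0:ℝ)..X, be a ρ y * f y / G0 a ρ y)
     - ∫ y in (0:ℝ)..X, be a ρ y * g y / G0 a ρ y := by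
    rw [← intervalIntegral.integral_sub ((q_cont hf).intervalIntegrable _ _) ((q_cont hg).intervalIntegrable _ _)]
    congr 1; ext y; ring
  rw [this]; ring

noncomputable def C4 (a : ℝ) : ℝ := 1 + 4 + (1/a+4)*Real.exp (1/a)
lemma C4_pos {a : ℝ} (ha : 0 < a) : 0 < C4 a := by unfold C4; positivity

lemma NN_bound {a ρ b : ℝ} (ha : 0 < a) (hρ : 0 < ρ) (hρ1 : ρ ≤ 1/4) (hb : 0 ≤ b) {f : ℝ → ℝ}
    (hf : Continuous f) (hfb : ∀ x, |f x| ≤ b * W a ρ x) (X : ℝ) :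
    |NN a ρ f X| ≤ C4 a * b * W a ρ X := by
  set κ := ρ/(1+ρ) with hκ
  have hκ1 : κ ≤ 1/4 := by rw [hκ, div_le_iff₀ (by linarith)]; nlinarith
  have hκ0 : 0 < κ := by positivity
  have hκ2 : 4/5*ρ ≤ κ := by rw [hκ, le_div_iff₀ (by linarith)]; nlinarith
  have hκ3 : κ ≤ ρ := by rw [hκ, div_le_iff₀ (by linarith)]; nlinarith
  have hWp := W_pos a ρ X
  have hqa : ∀ y, |be a ρ y * f y / G0 a ρ y| ≤ |be a ρ y| * (b * W a ρ y) / G0 a ρ y := by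
    intro y
    rw [abs_div, abs_mul, abs_of_pos (G0_pos a ρ y)]
    have := G0_pos a ρ y
    have := hfb y
    gcongr
  suffices hv : |G0 a ρ X * ∫ y in (0:ℝ)..X, be a ρ y * f y / G0 a ρ y| ≤ (4 + (1/a+4)*Real.exp (1/a)) * b * W a ρ X by
    unfold NN
    refine (abs_add_le _ _).trans ?_
    have := hfb X
    unfold C4
    linarith
  rw [abs_mul, abs_of_pos (G0_pos a ρ X)]
  rcases le_total 0 X with hX | hX
  · -- right
    set μ := κ - ρ/2 with hμ
    have hμ0 : 0 < μ := by rw [hμ]; linarith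
    have hμκ : κ ≤ 4 * μ := by rw [hμ]; linarith
    let Ψ : ℝ → ℝ := fun y => b * Real.exp (1/(2*a)) * (Real.exp (μ*X) * (-(Real.exp (-(a*y))/a)) + 4 * Real.exp (μ*y))
    let Ψ' : ℝ → ℝ := fun y => b * Real.exp (1/(2*a)) * (Real.exp (μ*X) * Real.exp (-(a*y)) + 4 * μ * Real.exp (μ*y))
    have hΨ : ∀ y, HasDerivAt Ψ (Ψ' y) y := by
      intro y
      have h1 : HasDerivAt (fun x : ℝ => -(a*x)) (-a) y := by
        simpa using ((hasDerivAt_id' y).const_mul a).fun_neg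
      have h2 : HasDerivAt (fun x : ℝ => μ*x) μ y := by
        simpa using ((hasDerivAt_id' y).const_mul μ)
      have := (((h1.exp.div_const a).fun_neg.const_mul (Real.exp (μ*X))).fun_add (h2.exp.const_mul 4)).const_mul
        (b * Real.exp (1/(2*a)))
      refine this.congr_deriv ?_
      simp only [Ψ']
      field_simp
    have hpt : ∀ y ∈ Icc 0 X, |be a ρ y * f y / G0 a ρ y| ≤ Ψ' y := by
      intro y hy
      refine (hqa y).trans ?_
      have e1 : |be a ρ y| ≤ Real.exp (-(a*y)) + κ := by
        unfold be
        rw [← hκ]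
        have := abs_sub (Real.exp (-(a*y))) κ
        rwa [abs_of_pos (Real.exp_pos _), abs_of_pos hκ0] at this
      have e2 : W a ρ y / G0 a ρ y ≤ Real.exp (1/(2*a)) * Real.exp (μ*y) := by
        unfold W V G0
        rw [max_eq_left hy.1, ← Real.exp_add, ← Real.exp_sub, ← Real.exp_add]
        apply Real.exp_le_exp.2
        have : Real.exp (-(a*y)) ≤ 1 := Real.exp_le_one_iff.2 (by nlinarith [hy.1])
        have h2 : Real.exp (-(a*y))/a/2 ≤ 1/(2*a) := by
          rw [div_div, mul_comm a 2]; gcongr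
        rw [← hκ, hμ]
        linarith
      have e3 : Real.exp (μ*y) ≤ Real.exp (μ*X) := Real.exp_le_exp.2 (by nlinarith [hy.2])
      have := W_pos a ρ y
      have := G0_pos a ρ y
      have p1 := Real.exp_pos (-(a*y))
      have p2 := Real.exp_pos (μ*y)
      calc |be a ρ y| * (b * W a ρ y) / G0 a ρ y = b * (|be a ρ y| * (W a ρ y / G0 a ρ y)) := by ring
        _ ≤ b * ((Real.exp (-(a*y)) + κ) * (Real.exp (1/(2*a)) * Real.exp (μ*y))) := by gcongr
        _ = b * Real.exp (1/(2*a)) * (Real.exp (μ*y) * Real.exp (-(a*y)) + κ * Real.exp (μ*y)) := by ring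
        _ ≤ _ := by simp only [Ψ']; gcongr
    have hint : |∫ y in (0:ℝ)..X, be a ρ y * f y / G0 a ρ y| ≤ Ψ X - Ψ 0 := by
      have hc : Continuous Ψ' := by simp only [Ψ']; fun_prop
      rw [← intervalIntegral.integral_eq_sub_of_hasDerivAt (fun y _ => hΨ y) (hc.intervalIntegrable _ _)]
      refine (intervalIntegral.abs_integral_le_integral_abs hX).trans ?_
      exact intervalIntegral.integral_mono_on hX ((q_cont hf).abs.intervalIntegrable _ _)
        (hc.intervalIntegrable _ _) hpt
    have hΨb : Ψ X - Ψ 0 ≤ b * Real.exp (1/(2*a)) * ((1/a+4) * Real.exp (μ*X)) := by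
      simp only [Ψ]
      rw [← mul_sub]
      apply mul_le_mul_of_nonneg_left _ (by positivity)
      have : 0 < Real.exp (μ*X) * (Real.exp (-(a*X))/a) := by positivity
      simp only [mul_zero, neg_zero, Real.exp_zero]
      linarith
    have hG : G0 a ρ X * Real.exp (μ*X) ≤ Real.exp (1/(2*a)) * W a ρ X := by
      unfold W V G0
      rw [max_eq_left hX, ← Real.exp_add, ← Real.exp_add, ← Real.exp_add]
      apply Real.exp_le_exp.2
      have : Real.exp (-(a*X)) ≤ 1 := Real.exp_le_one_iff.2 (by nlinarith)
      have h2 : Real.exp (-(a*X))/a/2 ≤ 1/(2*a) := by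
        rw [div_div, mul_comm a 2]; gcongr
      have h3 : 0 < Real.exp (-(a*X))/a := by positivity
      rw [← hκ, hμ]
      linarith
    have hee : Real.exp (1/(2*a)) * Real.exp (1/(2*a)) = Real.exp (1/a) := by
      rw [← Real.exp_add]; congr 1; field_simp; norm_num
    have hGp := G0_pos a ρ X
    calc _ ≤ G0 a ρ X * (b * Real.exp (1/(2*a)) * ((1/a+4) * Real.exp (μ*X))) := by
          gcongr; exact hint.trans hΨb
      _ = b * Real.exp (1/(2*a)) * (1/a+4) * (G0 a ρ X * Real.exp (μ*X)) := by ring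
      _ ≤ b * Real.exp (1/(2*a)) * (1/a+4) * (Real.exp (1/(2*a)) * W a ρ X) := by gcongr
      _ = (1/a+4) * (Real.exp (1/(2*a)) * Real.exp (1/(2*a))) * b * W a ρ X := by ring
      _ ≤ _ := by
        rw [hee]
        have : 0 ≤ b * W a ρ X := by positivity
        linarith
  · -- left
    let S : ℝ → ℝ := fun y => Real.exp (-(a*y))/a
    let Ψ : ℝ → ℝ := fun y => b * Real.exp (S X/4 + κ*X) * (-4 * Real.exp (S y/4))
    let Ψ' : ℝ → ℝ := fun y => b * Real.exp (S X/4 + κ*X) * (Real.exp (-(a*y)) * Real.exp (S y/4))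
    have hΨ : ∀ y, HasDerivAt Ψ (Ψ' y) y := by
      intro y
      have h1 : HasDerivAt (fun x : ℝ => -(a*x)) (-a) y := by
        simpa using ((hasDerivAt_id' y).const_mul a).fun_neg
      have := (((h1.exp.div_const a).div_const 4).exp.const_mul (-4)).const_mul
        (b * Real.exp (S X/4 + κ*X))
      refine this.congr_deriv ?_
      simp only [Ψ', S]
      field_simp
    have hpt : ∀ y ∈ Icc X 0, |be a ρ y * f y / G0 a ρ y| ≤ Ψ' y := by
      intro y hy
      refine (hqa y).trans ?_
      have e0 : 1 ≤ Real.exp (-(a*y)) := Real.one_le_exp (by nlinarith [hy.2])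
      have e1 : |be a ρ y| ≤ Real.exp (-(a*y)) := by
        unfold be
        rw [← hκ, abs_of_nonneg (by linarith)]
        linarith
      have e2 : W a ρ y / G0 a ρ y ≤ Real.exp (S X/4 + κ*X) * Real.exp (S y/4) := by
        unfold W V G0
        rw [max_eq_right hy.2, ← Real.exp_add, ← Real.exp_sub, ← Real.exp_add]
        apply Real.exp_le_exp.2
        have : Real.exp (-(a*X)) = Real.exp (-(a*y)) * Real.exp (a*(y-X)) := by
          rw [← Real.exp_add]; ring_nf
        have h1 := Real.add_one_le_exp (a*(y-X))
        have h3 : 0 ≤ a*(y-X) := mul_nonneg ha.le (by linarith [hy.1])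
        have h4 : Real.exp (-(a*y)) + a*(y-X) ≤ Real.exp (-(a*X)) := by rw [this]; nlinarith
        have h5 : S y + (y-X) ≤ S X := by
          simp only [S]
          rw [div_add' _ _ _ ha.ne', div_le_div_iff_of_pos_right ha]; linarith
        have h6 : κ*(y-X) ≤ 1/4*(y-X) := mul_le_mul_of_nonneg_right hκ1 (by linarith [hy.1])
        rw [← hκ]
        change -S y/2 + -(ρ/2*0) - (-S y - κ*y) ≤ S X/4+κ*X + S y/4
        linarith
      have := W_pos a ρ y
      have := G0_pos a ρ y
      calc |be a ρ y| * (b * W a ρ y) / G0 a ρ y = b * (|be a ρ y| * (W a ρ y / G0 a ρ y)) := by ring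
        _ ≤ b * (Real.exp (-(a*y)) * (Real.exp (S X/4 + κ*X) * Real.exp (S y/4))) := by gcongr
        _ = _ := by simp only [Ψ']; ring
    have hint : |∫ y in (0:ℝ)..X, be a ρ y * f y / G0 a ρ y| ≤ Ψ 0 - Ψ X := by
      have hc : Continuous Ψ' := by simp only [Ψ', S]; fun_prop
      rw [← intervalIntegral.integral_eq_sub_of_hasDerivAt (fun y _ => hΨ y) (hc.intervalIntegrable _ _)]
      rw [intervalIntegral.integral_symm, abs_neg]
      refine (intervalIntegral.abs_integral_le_integral_abs hX).trans ?_
      exact intervalIntegral.integral_mono_on hX ((q_cont hf).abs.intervalIntegrable _ _)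
        (hc.intervalIntegrable _ _) hpt
    have hΨb : Ψ 0 - Ψ X ≤ b * Real.exp (S X/4 + κ*X) * (4 * Real.exp (S X/4)) := by
      simp only [Ψ]
      rw [← mul_sub]
      apply mul_le_mul_of_nonneg_left _ (by positivity)
      have := Real.exp_pos (S 0/4)
      linarith
    have hG : G0 a ρ X * (Real.exp (S X/4 + κ*X) * Real.exp (S X/4)) = W a ρ X := by
      unfold W V G0
      rw [max_eq_right hX, ← Real.exp_add, ← Real.exp_add, ← Real.exp_add]
      simp only [S]
      congr 1
      rw [← hκ]; ring
    have hGp := G0_pos a ρ X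
    calc _ ≤ G0 a ρ X * (b * Real.exp (S X/4 + κ*X) * (4 * Real.exp (S X/4))) := by
          gcongr; exact hint.trans hΨb
      _ = 4 * b * (G0 a ρ X * (Real.exp (S X/4 + κ*X) * Real.exp (S X/4))) := by ring
      _ = 4 * b * W a ρ X := by rw [hG]
      _ ≤ _ := by
        have h1: 0 ≤ b * W a ρ X := by positivity
        have h2 : 0 ≤ (1/a+4)*Real.exp (1/a) := by positivity
        nlinarith [mul_nonneg h2 h1]
end FPE

namespace FPE

lemma G0_le_W {a ρ : ℝ} (ha : 0 < a) (hρ : 0 < ρ) (hρ1 : ρ ≤ 1/4) (x : ℝ) : G0 a ρ x ≤ W a ρ x := by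
  unfold G0 W V
  rw [← Real.exp_add]
  apply Real.exp_le_exp.2
  have hs : 0 < Real.exp (-(a*x))/a := div_pos (Real.exp_pos _) ha
  have hs2 : -x ≤ Real.exp (-(a*x))/a := by
    rw [le_div_iff₀ ha]
    have := Real.add_one_le_exp (-(a*x))
    nlinarith
  have hk1 : ρ/2 ≤ ρ/(1+ρ) := by
    apply div_le_div_of_nonneg_left hρ.le (by linarith) (by linarith)
  have hk2 : ρ/(1+ρ) ≤ 1/2 := by
    rw [div_le_iff₀ (by linarith)]; linarith
  rcases le_total x 0 with h | h
  · rw [max_eq_right h]; nlinarith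
  · rw [max_eq_left h]; nlinarith

lemma EE_total {a : ℝ} (ha : 0 < a) : ∫ x, EE a x = 2 := by
  have := integral_of_hasDerivAt_of_tendsto (f := fun x => 2 * V a x) (f' := EE a) (m := 2*0) (n := 2*1)
    (fun x => V_deriv ha x) (EE_int ha) ((V_tendsto_bot ha).const_mul 2) ((V_tendsto_top ha).const_mul 2)
  rw [this]; norm_num

lemma W_le_maj {a ρ : ℝ} (ha : 0 < a) (x : ℝ) :
    W a ρ x ≤ EE a x + (Ioi (0:ℝ)).indicator (fun x => Real.exp (-(ρ/2)*x)) x := by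
  have hE := EE_pos a x
  by_cases h : x ∈ Ioi (0:ℝ)
  · rw [indicator_of_mem h]
    have := W_le_exp (ρ := ρ) ha x
    rw [max_eq_left (le_of_lt h)] at this
    rw [show -(ρ/2)*x = -(ρ/2*x) by ring]
    linarith
  · rw [indicator_of_notMem h, add_zero]
    have h' : x ≤ 0 := not_lt.1 h
    unfold W EE
    rw [max_eq_right h']
    simp only [mul_zero, neg_zero, Real.exp_zero, mul_one]
    have : 1 ≤ Real.exp (-(a*x)) := Real.one_le_exp (by nlinarith)
    have := V_pos a x
    nlinarith

lemma Wmaj_int {a ρ : ℝ} (ha : 0 < a) (hρ : 0 < ρ) :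
    Integrable (fun x => EE a x + (Ioi (0:ℝ)).indicator (fun x => Real.exp (-(ρ/2)*x)) x) := by
  apply (EE_int ha).add
  exact (integrableOn_exp_mul_Ioi (by linarith) 0).integrable_indicator measurableSet_Ioi

lemma W_int {a ρ : ℝ} (ha : 0 < a) (hρ : 0 < ρ) : Integrable (W a ρ) := by
  refine (Wmaj_int ha hρ).mono' (W_cont a ρ).aestronglyMeasurable (Eventually.of_forall fun x => ?_)
  rw [Real.norm_eq_abs, abs_of_pos (W_pos _ _ _)]
  exact W_le_maj ha x

lemma W_integral {a ρ : ℝ} (ha : 0 < a) (hρ : 0 < ρ) (hρ1 : ρ ≤ 1/4) : ρ * ∫ x, W a ρ x ≤ 3 := by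
  have h := integral_mono (W_int ha hρ) (Wmaj_int ha hρ) (fun x => W_le_maj ha x)
  rw [integral_add (EE_int ha) ((integrableOn_exp_mul_Ioi (by linarith) 0).integrable_indicator measurableSet_Ioi),
    EE_total ha, integral_indicator measurableSet_Ioi, integral_exp_mul_Ioi (by linarith)] at h
  have h2 : -Real.exp (-(ρ/2)*0) / -(ρ/2) = 2/ρ := by
    rw [mul_zero, Real.exp_zero]; field_simp
  rw [h2] at h
  have : ρ * ∫ x, W a ρ x ≤ ρ * (2 + 2/ρ) := by gcongr
  have h3 : ρ * (2 + 2/ρ) = 2*ρ+2 := by field_simp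
  linarith

lemma G0_int {a ρ : ℝ} (ha : 0 < a) (hρ : 0 < ρ) (hρ1 : ρ ≤ 1/4) : Integrable (G0 a ρ) := by
  refine (W_int ha hρ).mono' (G0_cont a ρ).aestronglyMeasurable (Eventually.of_forall fun x => ?_)
  rw [Real.norm_eq_abs, abs_of_pos (G0_pos _ _ _)]
  exact G0_le_W ha hρ hρ1 x

lemma G0_integral {a ρ : ℝ} (ha : 0 < a) (hρ : 0 < ρ) (hρ1 : ρ ≤ 1/4) (hρ2 : ρ ≤ a^2/5) :
    4/5 ≤ ρ * ∫ x, G0 a ρ x := by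
  set κ := ρ/(1+ρ) with hκ
  have hκ0 : 0 < κ := by positivity
  have i1 : IntegrableOn (fun x => Real.exp (-κ*x)) (Ioi 0) := integrableOn_exp_mul_Ioi (by linarith) 0
  have i2 : IntegrableOn (fun x => Real.exp (-a*x)/a) (Ioi 0) :=
    (integrableOn_exp_mul_Ioi (by linarith) 0).div_const a
  have h := integral_mono ((i1.sub i2).integrable_indicator measurableSet_Ioi) (G0_int ha hρ hρ1) (fun x => by
    show _ ≤ G0 a ρ x
    by_cases h : x ∈ Ioi (0:ℝ)
    · rw [indicator_of_mem h]
      simp only [Pi.sub_apply]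
      unfold G0
      rw [← hκ, show -(Real.exp (-(a*x))/a) - κ*x = -(Real.exp (-(a*x))/a) + (-κ*x) by ring, Real.exp_add,
        show -a*x = -(a*x) by ring]
      have e1 := Real.add_one_le_exp (-(Real.exp (-(a*x))/a))
      have e2 : Real.exp (-κ*x) ≤ 1 := Real.exp_le_one_iff.2 (by have : 0 < x := h; nlinarith)
      have e3 := Real.exp_pos (-κ*x)
      have hs : 0 < Real.exp (-(a*x))/a := div_pos (Real.exp_pos _) ha
      nlinarith
    · rw [indicator_of_notMem h]; exact (G0_pos _ _ _).le)
  rw [integral_indicator measurableSet_Ioi] at h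
  simp only [Pi.sub_apply] at h
  rw [integral_sub i1 i2, integral_div, integral_exp_mul_Ioi (by linarith), integral_exp_mul_Ioi (by linarith)] at h
  have h2 : -Real.exp (-κ*0) / -κ - -Real.exp (-a*0) / -a/a = 1/κ - 1/a^2 := by
    rw [mul_zero, mul_zero, Real.exp_zero]; field_simp
  rw [h2] at h
  have h3 : ρ * (1/κ - 1/a^2) ≤ ρ * ∫ x, G0 a ρ x := by gcongr
  have h4 : ρ * (1/κ - 1/a^2) = 1 + ρ - ρ/a^2 := by rw [hκ]; field_simp
  have h5 : ρ/a^2 ≤ 1/5 := by rw [div_le_iff₀ (by positivity)]; linarith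
  linarith

lemma W_tendsto_bot {a ρ : ℝ} (ha : 0 < a) (hρ : 0 < ρ) : Tendsto (W a ρ) atBot (nhds 0) :=
  squeeze_zero (fun x => (W_pos a ρ x).le) (fun x => W_le_V hρ x) (V_tendsto_bot ha)

lemma W_tendsto_top {a ρ : ℝ} (ha : 0 < a) (hρ : 0 < ρ) : Tendsto (W a ρ) atTop (nhds 0) := by
  refine squeeze_zero (fun x => (W_pos a ρ x).le) (fun x => (W_le_exp ha x).trans
    (Real.exp_le_exp.2 (show _ ≤ -(ρ/2*x) by have := le_max_left x 0; nlinarith))) ?_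
  apply Real.tendsto_exp_atBot.comp
  apply tendsto_neg_atTop_atBot.comp
  exact tendsto_id.const_mul_atTop (by linarith)

end FPE

namespace FPE

noncomputable def Fu (a ρ : ℝ) (u : ℝ → ℝ) (y z : ℝ) : ℝ := (u y * W a ρ y) * (u z * W a ρ z)
noncomputable def RR (K : ℝ → ℝ → ℝ) (a ρ : ℝ) (u : ℝ → ℝ) (X : ℝ) : ℝ := NN a ρ (Rem K a ρ (Fu a ρ u)) X
noncomputable def cc (K : ℝ → ℝ → ℝ) (a ρ : ℝ) (u : ℝ → ℝ) : ℝ :=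
  (1 - ρ * ∫ x, RR K a ρ u x) / (ρ * ∫ x, G0 a ρ x)
noncomputable def TT (K : ℝ → ℝ → ℝ) (a ρ : ℝ) (u : ℝ → ℝ) (X : ℝ) : ℝ := cc K a ρ u * G0 a ρ X + RR K a ρ u X

lemma Fu_cont {a ρ : ℝ} {u : ℝ → ℝ} (hu : Continuous u) : Continuous (Function.uncurry (Fu a ρ u)) := by
  have := W_cont a ρ
  unfold Fu Function.uncurry
  fun_prop

lemma Fu_bound {a ρ : ℝ} {u : ℝ → ℝ} (hb : ∀ x, |u x| ≤ 2) (y z : ℝ) :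
    |Fu a ρ u y z| ≤ 4 * (W a ρ y * W a ρ z) := by
  unfold Fu
  have h1 := W_pos a ρ y
  have h2 := W_pos a ρ z
  rw [abs_mul, abs_mul, abs_mul, abs_of_pos h1, abs_of_pos h2]
  have : |u y| * |u z| ≤ 2*2 := mul_le_mul (hb y) (hb z) (abs_nonneg _) (by norm_num)
  have := mul_le_mul_of_nonneg_right this (mul_pos h1 h2).le
  nlinarith

lemma Fu_lip {a ρ d : ℝ} {u v : ℝ → ℝ} (hu : ∀ x, |u x| ≤ 2) (hv : ∀ x, |v x| ≤ 2)
    (hd : ∀ x, |u x - v x| ≤ d) (y z : ℝ) :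
    |Fu a ρ u y z - Fu a ρ v y z| ≤ 4 * d * (W a ρ y * W a ρ z) := by
  have h1 := W_pos a ρ y
  have h2 := W_pos a ρ z
  have e : Fu a ρ u y z - Fu a ρ v y z = ((u y - v y) * u z + v y * (u z - v z)) * (W a ρ y * W a ρ z) := by
    unfold Fu; ring
  rw [e, abs_mul, abs_of_pos (mul_pos h1 h2)]
  apply mul_le_mul_of_nonneg_right _ (mul_pos h1 h2).le
  refine (abs_add_le _ _).trans ?_
  rw [abs_mul, abs_mul]
  have hd0 : 0 ≤ d := (abs_nonneg _).trans (hd 0)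
  have := mul_le_mul (hd y) (hu z) (abs_nonneg _) hd0
  have := mul_le_mul (hv y) (hd z) (abs_nonneg _) (by norm_num)
  linarith

noncomputable def eta (a C δ ρ : ℝ) : ℝ := C4 a * (ρ * (4 * (2 * C2 C δ)))

variable {K : ℝ → ℝ → ℝ} {a C δ ρ : ℝ}

lemma RR_cont (H : KH K a C δ) (hρ : 0 < ρ) (hρ1 : ρ ≤ 1/4) {u : ℝ → ℝ} (hu : Continuous u)
    (hb : ∀ x, |u x| ≤ 2) : Continuous (RR K a ρ u) :=
  NN_cont H.ha ρ (Rem_cont H hρ (by linarith) (by norm_num) (Fu_cont hu) (Fu_bound hb))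

lemma RR_bound (H : KH K a C δ) (hρ : 0 < ρ) (hρ1 : ρ ≤ 1/4) {u : ℝ → ℝ} (hu : Continuous u)
    (hb : ∀ x, |u x| ≤ 2) (X : ℝ) : |RR K a ρ u X| ≤ eta a C δ ρ * W a ρ X :=
  NN_bound H.ha hρ hρ1 (by have := C2_pos (δ := δ) H.hC; positivity)
    (Rem_cont H hρ (by linarith) (by norm_num) (Fu_cont hu) (Fu_bound hb))
    (Rem_bound H hρ (by linarith) (by norm_num) (Fu_bound hb)) X

lemma RR_lip (H : KH K a C δ) (hρ : 0 < ρ) (hρ1 : ρ ≤ 1/4) {u v : ℝ → ℝ} (hu : Continuous u)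
    (hv : Continuous v) {d : ℝ}
    (hb : ∀ x, |u x| ≤ 2) (hb' : ∀ x, |v x| ≤ 2) (hd : ∀ x, |u x - v x| ≤ d) (X : ℝ) :
    |RR K a ρ u X - RR K a ρ v X| ≤ eta a C δ ρ * d * W a ρ X := by
  have hd0 : 0 ≤ d := (abs_nonneg _).trans (hd 0)
  have hr1 : ρ ≤ 1 := by linarith
  have c1 := Rem_cont H hρ hr1 (by norm_num) (Fu_cont hu) (Fu_bound hb)
  have c2 := Rem_cont H hρ hr1 (by norm_num) (Fu_cont hv) (Fu_bound hb')
  unfold RR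
  rw [NN_sub ρ c1 c2]
  have hC2 := C2_pos (δ := δ) H.hC
  have := NN_bound (b := ρ * (4 * d * (2 * C2 C δ))) H.ha hρ hρ1 (by positivity) (c1.sub c2) (fun x => by
    show |Rem K a ρ (Fu a ρ u) x - Rem K a ρ (Fu a ρ v) x| ≤ _
    rw [Rem_sub H hρ hr1 (by norm_num) (by norm_num) (Fu_cont hu) (Fu_cont hv) (Fu_bound hb) (Fu_bound hb')]
    exact Rem_bound H hρ hr1 (by positivity) (Fu_lip hb hb' hd) x) X
  refine this.trans (le_of_eq ?_)
  unfold eta; ring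

lemma RR_int (H : KH K a C δ) (hρ : 0 < ρ) (hρ1 : ρ ≤ 1/4) {u : ℝ → ℝ} (hu : Continuous u)
    (hb : ∀ x, |u x| ≤ 2) : Integrable (RR K a ρ u) :=
  ((W_int H.ha hρ).const_mul (eta a C δ ρ)).mono' (RR_cont H hρ hρ1 hu hb).aestronglyMeasurable
    (Eventually.of_forall (RR_bound H hρ hρ1 hu hb))

lemma int_bound {a ρ b : ℝ} (ha : 0 < a) (hρ : 0 < ρ) (hρ1 : ρ ≤ 1/4) (hb : 0 ≤ b) {f : ℝ → ℝ}
    (hf : ∀ x, |f x| ≤ b * W a ρ x) : |ρ * ∫ x, f x| ≤ 3 * b := by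
  have := norm_integral_le_of_norm_le (f := f) ((W_int ha hρ).const_mul b) (Eventually.of_forall hf)
  rw [integral_const_mul] at this
  have h3 := W_integral ha hρ hρ1
  rw [abs_mul, abs_of_pos hρ]
  calc
    ρ * |∫ x, f x| ≤ ρ * (b * ∫ x, W a ρ x) := by gcongr; exact this
    _ = b * (ρ * ∫ x, W a ρ x) := by ring
    _ ≤ b * 3 := by gcongr
    _ = 3 * b := by ring

lemma eta_nonneg (H : KH K a C δ) (hρ : 0 < ρ) : 0 ≤ eta a C δ ρ := by
  have := C2_pos (δ := δ) H.hC
  have := C4_pos H.ha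
  unfold eta; positivity

lemma TT_cont (H : KH K a C δ) (hρ : 0 < ρ) (hρ1 : ρ ≤ 1/4) {u : ℝ → ℝ} (hu : Continuous u)
    (hb : ∀ x, |u x| ≤ 2) : Continuous (TT K a ρ u) := by
  have := RR_cont H hρ hρ1 hu hb
  have := G0_cont a ρ
  unfold TT
  fun_prop

lemma div_bound {p q : ℝ} (hq : 4/5 ≤ q) : |p / q| ≤ 5/4 * |p| := by
  rw [abs_div, abs_of_pos (show 0 < q by linarith), div_le_iff₀ (by linarith)]
  have := abs_nonneg p
  nlinarith

lemma TT_bound (H : KH K a C δ) (hρ : 0 < ρ) (hρ1 : ρ ≤ 1/4) (hρ2 : ρ ≤ a^2/5)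
    (he : eta a C δ ρ ≤ 1/10) {u : ℝ → ℝ} (hu : Continuous u)
    (hb : ∀ x, |u x| ≤ 2) (X : ℝ) : |TT K a ρ u X| ≤ 2 * W a ρ X := by
  have hη := eta_nonneg H hρ
  have hc : |cc K a ρ u| ≤ 5/4 * (1 + 3 * (1/10)) := by
    refine (div_bound (G0_integral H.ha hρ hρ1 hρ2)).trans ?_
    have h1 := int_bound H.ha hρ hρ1 hη (RR_bound H hρ hρ1 hu hb)
    have h2 := abs_sub (1:ℝ) (ρ * ∫ x, RR K a ρ u x)
    rw [abs_one] at h2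
    linarith
  have hW := W_pos a ρ X
  have hG := G0_le_W H.ha hρ hρ1 X
  have hR := RR_bound H hρ hρ1 hu hb X
  unfold TT
  refine (abs_add_le _ _).trans ?_
  rw [abs_mul, abs_of_pos (G0_pos a ρ X)]
  have := mul_le_mul hc hG (G0_pos a ρ X).le (by norm_num)
  have := mul_le_mul_of_nonneg_right he hW.le
  linarith

lemma TT_lip (H : KH K a C δ) (hρ : 0 < ρ) (hρ1 : ρ ≤ 1/4) (hρ2 : ρ ≤ a^2/5)
    (he : eta a C δ ρ ≤ 1/10) {u v : ℝ → ℝ} (hu : Continuous u)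
    (hv : Continuous v) {d : ℝ}
    (hb : ∀ x, |u x| ≤ 2) (hb' : ∀ x, |v x| ≤ 2) (hd : ∀ x, |u x - v x| ≤ d) (X : ℝ) :
    |TT K a ρ u X - TT K a ρ v X| ≤ 1/2 * d * W a ρ X := by
  have hd0 : 0 ≤ d := (abs_nonneg _).trans (hd 0)
  have hη := eta_nonneg H hρ
  have hηd : eta a C δ ρ * d ≤ 1/10 * d := by gcongr
  have hc : |cc K a ρ u - cc K a ρ v| ≤ 5/4 * (3 * (1/10 * d)) := by
    unfold cc
    rw [← sub_div]
    refine (div_bound (G0_integral H.ha hρ hρ1 hρ2)).trans ?_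
    have h1 := int_bound H.ha hρ hρ1 (by positivity) (RR_lip H hρ hρ1 hu hv hb hb' hd)
    rw [integral_sub (RR_int H hρ hρ1 hu hb) (RR_int H hρ hρ1 hv hb')] at h1
    rw [show ∀ p q : ℝ, 1 - ρ*p - (1 - ρ*q) = -(ρ*(p-q)) by intros; ring, abs_neg]
    linarith
  have hW := W_pos a ρ X
  have hG := G0_le_W H.ha hρ hρ1 X
  have hR := RR_lip H hρ hρ1 hu hv hb hb' hd X
  unfold TT
  rw [show ∀ p q r s t : ℝ, p*q+r - (s*q+t) = (p-s)*q + (r-t) by intros; ring]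
  refine (abs_add_le _ _).trans ?_
  rw [abs_mul, abs_of_pos (G0_pos a ρ X)]
  have := mul_le_mul hc hG (G0_pos a ρ X).le (by positivity)
  have := mul_le_mul_of_nonneg_right hηd hW.le
  have : 0 ≤ d * W a ρ X := by positivity
  linarith

open BoundedContinuousFunction in
lemma exists_fp (H : KH K a C δ) (hρ : 0 < ρ) (hρ1 : ρ ≤ 1/4) (hρ2 : ρ ≤ a^2/5)
    (he : eta a C δ ρ ≤ 1/10) : ∃ u : ℝ → ℝ, Continuous u ∧ (∀ x, |u x| ≤ 2) ∧
      ∀ X, u X * W a ρ X = TT K a ρ u X := by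
  have hB : ∀ u : Metric.closedBall (0 : ℝ →ᵇ ℝ) 2, ∀ x, |u.1 x| ≤ 2 := fun u x => by
    have h := u.2
    rw [mem_closedBall_zero_iff] at h
    exact (u.1.norm_coe_le_norm x).trans h
  have hN : ∀ u : Metric.closedBall (0 : ℝ →ᵇ ℝ) 2, ∀ x, ‖TT K a ρ u.1 x / W a ρ x‖ ≤ 2 := fun u x => by
    rw [Real.norm_eq_abs, abs_div, abs_of_pos (W_pos a ρ x), div_le_iff₀ (W_pos a ρ x)]
    exact TT_bound H hρ hρ1 hρ2 he u.1.continuous (hB u) x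
  let T : Metric.closedBall (0 : ℝ →ᵇ ℝ) 2 → Metric.closedBall (0 : ℝ →ᵇ ℝ) 2 := fun u =>
    ⟨ofNormedAddCommGroup (fun x => TT K a ρ u.1 x / W a ρ x)
      ((TT_cont H hρ hρ1 u.1.continuous (hB u)).div (W_cont a ρ) (fun x => (W_pos a ρ x).ne')) 2 (hN u),
      by
        rw [mem_closedBall_zero_iff]
        exact norm_ofNormedAddCommGroup_le _ (by norm_num) (hN u)⟩
  have hT : ContractingWith (1/2) T := by
    refine ⟨by norm_num, LipschitzWith.of_dist_le_mul fun u v => ?_⟩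
    rw [Subtype.dist_eq]
    rw [dist_le (by positivity)]
    intro x
    show dist (TT K a ρ u.1 x / W a ρ x) (TT K a ρ v.1 x / W a ρ x) ≤ _
    rw [Real.dist_eq, ← sub_div, abs_div, abs_of_pos (W_pos a ρ x), div_le_iff₀ (W_pos a ρ x)]
    have := TT_lip H hρ hρ1 hρ2 he u.1.continuous v.1.continuous (hB u) (hB v) (d := dist u v)
      (fun x => by rw [← Real.dist_eq]; exact dist_coe_le_dist (f := u.1) (g := v.1) x) x
    simpa using this
  have : CompleteSpace (Metric.closedBall (0 : ℝ →ᵇ ℝ) 2) := Metric.isClosed_closedBall.completeSpace_coe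
  have : Nonempty (Metric.closedBall (0 : ℝ →ᵇ ℝ) 2) := ⟨⟨0, by simp⟩⟩
  have hfix := hT.fixedPoint_isFixedPt
  set w := ContractingWith.fixedPoint T hT
  refine ⟨w.1, w.1.continuous, hB w, fun X => ?_⟩
  have h2 : (T w).1 X = w.1 X := by rw [hfix]
  have h3 : TT K a ρ w.1 X / W a ρ X = w.1 X := h2
  rw [← h3, div_mul_cancel₀ _ (W_pos a ρ X).ne']

end FPE

namespace FPE

variable {K : ℝ → ℝ → ℝ} {a C δ ρ : ℝ}

lemma ind_Iio (f : ℝ → ℝ) (X : ℝ) : (fun s : ℝ => if s < 0 then f (X+s) else 0) =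
    fun s => (Iio X).indicator f (X+s) := by
  ext s
  by_cases h : s < 0
  · rw [indicator_of_mem (by simpa using h), if_pos h]
  · rw [indicator_of_notMem (by simpa using h), if_neg h]

lemma ind_Ioi (f : ℝ → ℝ) (X : ℝ) : (fun s : ℝ => if 0 < s then f (X+s) else 0) =
    fun s => (Ioi X).indicator f (X+s) := by
  ext s
  by_cases h : 0 < s
  · rw [indicator_of_mem (by simpa using h), if_pos h]
  · rw [indicator_of_notMem (by simpa using h), if_neg h]

lemma int_Iio {f : ℝ → ℝ} (hf : Integrable f) (X : ℝ) : Integrable (fun s : ℝ => if s < 0 then f (X+s) else 0) := by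
  rw [ind_Iio]; exact (hf.indicator measurableSet_Iio).comp_add_left X
lemma int_Ioi {f : ℝ → ℝ} (hf : Integrable f) (X : ℝ) : Integrable (fun s : ℝ => if 0 < s then f (X+s) else 0) := by
  rw [ind_Ioi]; exact (hf.indicator measurableSet_Ioi).comp_add_left X
lemma integral_Iio' (f : ℝ → ℝ) (X : ℝ) : ∫ s : ℝ, (if s < 0 then f (X+s) else 0) = ∫ y in Iic X, f y := by
  rw [ind_Iio, integral_add_left_eq_self ((Iio X).indicator f), integral_indicator measurableSet_Iio,
    integral_Iic_eq_integral_Iio]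
lemma integral_Ioi' (f : ℝ → ℝ) (X : ℝ) : ∫ s : ℝ, (if 0 < s then f (X+s) else 0) = ∫ y in Ioi X, f y := by
  rw [ind_Ioi, integral_add_left_eq_self ((Ioi X).indicator f), integral_indicator measurableSet_Ioi]

noncomputable def PP (K : ℝ → ℝ → ℝ) (a X : ℝ) (g : ℝ → ℝ) (p : ℝ × ℝ) : ℝ :=
  Real.exp (-(a*X)) * (if p.1 < 0 ∧ Real.log (1 - Real.exp p.1) < p.2 then kk K a p.1 p.2 else 0) *
    (g (X+p.1) * g (X+p.2))
noncomputable def JJ (a X : ℝ) (g : ℝ → ℝ) (p : ℝ × ℝ) : ℝ :=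
  Real.exp (-(a*X)) * (if p.1 < 0 ∧ 0 < p.2 then Real.exp (-(a*p.1)) - Real.exp (-(a*p.2)) else 0) *
    (g (X+p.1) * g (X+p.2))
noncomputable def qq (a : ℝ) (g : ℝ → ℝ) (x : ℝ) : ℝ := Real.exp (-(a*x)) * g x

lemma JJ_eq (a X : ℝ) (g : ℝ → ℝ) : JJ a X g = fun p =>
    (if p.1 < 0 then qq a g (X+p.1) else 0) * (if 0 < p.2 then g (X+p.2) else 0) -
    (if p.1 < 0 then g (X+p.1) else 0) * (if 0 < p.2 then qq a g (X+p.2) else 0) := by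
  ext ⟨s, t⟩
  unfold JJ qq
  dsimp only
  by_cases hs : s < 0 <;> by_cases ht : 0 < t <;> simp only [hs, ht, if_true, if_false, and_true, and_false, mul_zero, zero_mul, sub_zero]
  rw [show -(a*(X+s)) = -(a*X) + -(a*s) by ring, show -(a*(X+t)) = -(a*X) + -(a*t) by ring, Real.exp_add, Real.exp_add]
  ring

lemma JJ_int {g : ℝ → ℝ} (hg : Integrable g) (hq : Integrable (qq a g)) (X : ℝ) : Integrable (JJ a X g) := by
  rw [JJ_eq]
  exact ((int_Iio hq X).mul_prod (int_Ioi hg X)).sub ((int_Iio hg X).mul_prod (int_Ioi hq X))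

lemma JJ_integral {g : ℝ → ℝ} (hg : Integrable g) (hq : Integrable (qq a g)) (X : ℝ) :
    ∫ p, JJ a X g p = (∫ x in Iic X, qq a g x) * (∫ x, g x) - (∫ x in Iic X, g x) * (∫ x, qq a g x) := by
  rw [JJ_eq, integral_sub, Measure.volume_eq_prod,
    integral_prod_mul (fun s => if s < 0 then qq a g (X+s) else 0) (fun s => if 0 < s then g (X+s) else 0),
    integral_prod_mul (fun s => if s < 0 then g (X+s) else 0) (fun s => if 0 < s then qq a g (X+s) else 0),
    integral_Iio', integral_Iio', integral_Ioi', integral_Ioi',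
    ← intervalIntegral.integral_Iic_add_Ioi (b := X) hg.integrableOn hg.integrableOn,
    ← intervalIntegral.integral_Iic_add_Ioi (b := X) hq.integrableOn hq.integrableOn]
  · ring
  · exact (int_Iio hq X).mul_prod (int_Ioi hg X)
  · exact (int_Iio hg X).mul_prod (int_Ioi hq X)

lemma exists_g (H : KH K a C δ) (hρ : 0 < ρ) (hρ1 : ρ ≤ 1/4) (hρ2 : ρ ≤ a^2/5)
    (he : eta a C δ ρ ≤ 1/10) : ∃ g : ℝ → ℝ, Continuous g ∧ (∀ x, |g x| ≤ 2 * W a ρ x) ∧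
      ρ * ∫ x, g x = 1 ∧ ∫ x, qq a g x = 1/(1+ρ) ∧
      ∀ X, Integrable (PP K a X g) ∧ g X = ρ * ∫ p, PP K a X g p := by
  obtain ⟨u, hu, hb, hfix⟩ := exists_fp H hρ hρ1 hρ2 he
  have ha := H.ha
  have hr1 : ρ ≤ 1 := by linarith
  set g : ℝ → ℝ := fun x => u x * W a ρ x with hgdef
  have hgc : Continuous g := hu.mul (W_cont a ρ)
  have hgb : ∀ x, |g x| ≤ 2 * W a ρ x := fun x => by
    rw [hgdef]; dsimp only
    rw [abs_mul, abs_of_pos (W_pos a ρ x)]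
    exact mul_le_mul_of_nonneg_right (hb x) (W_pos a ρ x).le
  have hgi : Integrable g :=
    ((W_int ha hρ).const_mul 2).mono' hgc.aestronglyMeasurable (Eventually.of_forall hgb)
  have hqc : Continuous (qq a g) := by unfold qq; fun_prop
  have hqi : Integrable (qq a g) := by
    refine ((EE_int ha).const_mul 2).mono' hqc.aestronglyMeasurable (Eventually.of_forall fun x => ?_)
    unfold qq EE
    rw [norm_mul, Real.norm_eq_abs, Real.norm_eq_abs, abs_of_pos (Real.exp_pos _)]
    have h1 := hgb x
    have h2 := W_le_V (a := a) hρ x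
    have h3 := Real.exp_pos (-(a*x))
    calc
      Real.exp (-(a*x)) * |g x| ≤ Real.exp (-(a*x)) * (2 * V a x) := by gcongr; linarith
      _ = 2 * (Real.exp (-(a*x)) * V a x) := by ring
  have hG1 : ρ * ∫ x, g x = 1 := by
    have e : g = fun x => cc K a ρ u * G0 a ρ x + RR K a ρ u x := by
      ext x; exact hfix x
    rw [e, integral_add ((G0_int ha hρ hρ1).const_mul _) (RR_int H hρ hρ1 hu hb), integral_const_mul, cc]
    have := G0_integral ha hρ hρ1 hρ2
    have h0 : ∫ x, G0 a ρ x ≠ 0 := by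
      intro h; rw [h] at this; norm_num at this
    field_simp
    ring
  set f := Rem K a ρ (Fu a ρ u) with hf
  have hfc : Continuous f := Rem_cont H hρ hr1 (by norm_num) (Fu_cont hu) (Fu_bound hb)
  have hfb := Rem_bound H hρ hr1 (by norm_num) (Fu_bound (a := a) (ρ := ρ) hb)
  set v : ℝ → ℝ := fun X => G0 a ρ X * (cc K a ρ u + ∫ y in (0:ℝ)..X, be a ρ y * f y / G0 a ρ y) with hv
  have hgv : ∀ x, g x = v x + f x := fun x => by
    have := hfix x
    unfold TT RR NN at this
    rw [hgdef, hv]; dsimp only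
    rw [this]; ring
  have hvd : ∀ x, HasDerivAt v (be a ρ x * g x) x := fun x => by
    rw [hgv]; exact v_deriv ha ρ _ x hfc
  obtain ⟨B, hB⟩ : ∃ B, ∀ x, |v x| ≤ B * W a ρ x := by
    refine ⟨2 + ρ * (4 * (2 * C2 C δ)), fun x => ?_⟩
    have : v x = g x - f x := by rw [hgv]; ring
    rw [this, add_mul]
    exact (abs_sub _ _).trans (add_le_add (hgb x) (hfb x))
  have hvb : Tendsto v atBot (nhds 0) := by
    apply squeeze_zero_norm hB
    simpa using (W_tendsto_bot ha hρ).const_mul B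
  have hvt : Tendsto v atTop (nhds 0) := by
    apply squeeze_zero_norm hB
    simpa using (W_tendsto_top ha hρ).const_mul B
  have hbe : (fun x => be a ρ x * g x) = fun x => qq a g x - ρ/(1+ρ) * g x := by
    ext x; unfold be qq; ring
  have hbi : Integrable (fun x => be a ρ x * g x) := by
    rw [hbe]; exact hqi.sub (hgi.const_mul _)
  have h1 := integral_of_hasDerivAt_of_tendsto hvd hbi hvb hvt
  have h2 : ∀ X, ∫ x in Iic X, be a ρ x * g x = v X - 0 := fun X =>
    integral_Iic_of_hasDerivAt_of_tendsto' (fun x _ => hvd x) hbi.integrableOn hvb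
  rw [hbe] at h1 h2
  rw [integral_sub hqi (hgi.const_mul _), integral_const_mul] at h1
  have hG2 : ∫ x, g x = 1/ρ := by field_simp; linarith
  have hQ : ∫ x, qq a g x = 1/(1+ρ) := by
    rw [hG2] at h1
    have : ρ/(1+ρ) * (1/ρ) = 1/(1+ρ) := by field_simp
    linarith
  refine ⟨g, hgc, hgb, hG1, hQ, fun X => ?_⟩
  have hMJ : PP K a X g = fun p => Real.exp (-(a*X)) * MM K a p * Fu a ρ u (X+p.1) (X+p.2) + JJ a X g p := by
    ext p
    unfold PP JJ MM Fu
    rw [hgdef]; dsimp only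
    ring
  have hMi := Rem_integrable H hρ hr1 (by norm_num) (Fu_cont hu) (Fu_bound hb) X
  refine ⟨by rw [hMJ]; exact hMi.add (JJ_int hgi hqi X), ?_⟩
  rw [hMJ, integral_add hMi (JJ_int hgi hqi X), mul_add]
  change _ = f X + _
  rw [JJ_integral hgi hqi, hG2, hQ, hgv X]
  have h3 := h2 X
  rw [integral_sub hqi.integrableOn (hgi.integrableOn.const_mul _), integral_const_mul] at h3
  have : v X = (∫ x in Iic X, qq a g x) - ρ/(1+ρ) * ∫ x in Iic X, g x := by linarith
  rw [this]
  field_simp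
  ring

lemma subst_int (ρ x : ℝ) (hρ : 0 < ρ) (f : ℝ → ℝ) : ∫ y, f y = ρ * ∫ s, f (x + ρ*s) := by
  have h := Measure.integral_comp_mul_left (fun y => f (x+y)) ρ
  rw [integral_add_left_eq_self f x, smul_eq_mul, abs_of_pos (inv_pos.2 hρ)] at h
  rw [h]; field_simp

lemma solves (hρ : 0 < ρ) {g : ℝ → ℝ}
    (hg : ∀ X, Integrable (PP K a X g) ∧ g X = ρ * ∫ p, PP K a X g p) :
    solvesE K a ρ (fun x => g (x/ρ)) := by
  intro x
  obtain ⟨h1, h2⟩ := hg (x/ρ)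
  dsimp only
  rw [h2, Measure.volume_eq_prod, integral_prod _ h1]
  rw [← integral_indicator measurableSet_Iio, subst_int ρ x hρ ((Iio x).indicator _)]
  have key : ∀ s, (Iio x).indicator (fun y => ∫ z in Ioi (x + ρ * Real.log (1 - Real.exp ((y-x)/ρ))),
      Real.exp (-(a/ρ)*z) * K (Real.exp ((y-z)/ρ)) 1 * g (y/ρ) * g (z/ρ)) (x+ρ*s) =
      ρ * ∫ t, PP K a (x/ρ) g (s,t) := by
    intro s
    by_cases hs : s < 0
    · rw [indicator_of_mem (by simp only [mem_Iio]; nlinarith), ← integral_indicator measurableSet_Ioi,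
        subst_int ρ x hρ]
      congr 1
      apply integral_congr_ae (Eventually.of_forall fun t => ?_)
      unfold PP kk
      dsimp only
      have e1 : (x + ρ*s - x)/ρ = s := by field_simp; ring
      have e2 : ∀ r, (x+ρ*r)/ρ = x/ρ + r := fun r => by field_simp
      have e3 : (x + ρ*s - (x+ρ*t))/ρ = s - t := by field_simp; ring
      have e4 : -(a/ρ)*(x+ρ*t) = -(a*(x/ρ)) + -(a*t) := by field_simp; ring
      rw [e1]
      by_cases ht : Real.log (1 - Real.exp s) < t
      · rw [indicator_of_mem (by simp only [mem_Ioi]; nlinarith), if_pos ⟨hs, ht⟩, e2, e2, e3, e4, Real.exp_add]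
        ring
      · rw [indicator_of_notMem (by simp only [mem_Ioi]; intro h; apply ht; nlinarith), if_neg (fun h => ht h.2)]
        ring
    · rw [indicator_of_notMem (by simp only [mem_Iio]; intro h; apply hs; nlinarith)]
      have : (fun t => PP K a (x/ρ) g (s,t)) = fun _ => 0 := by
        ext t; unfold PP
        rw [if_neg (fun h => hs h.1)]; ring
      rw [this]; simp
  refine Eq.trans ?_ (congrArg (fun r => 1/ρ*(ρ*r)) (integral_congr_ae (μ := volume) (Eventually.of_forall key)).symm)
  rw [integral_const_mul]
  field_simp

lemma W_omega {m L : ℝ} (ha : 0 < a) (hρ : 0 < ρ) (hm : 0 < m) (hL0 : 0 < L) (hL : 4*m ≤ Real.exp (a*L)) (x : ℝ) :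
    W a ρ (x/ρ) ≤ Real.exp (omegaFn m L ρ x) := by
  have hx : x = ρ * (x/ρ) := by field_simp
  generalize x/ρ = X at hx
  subst hx
  unfold omegaFn
  split_ifs with h1 h2
  · have hX : X ≤ -L := by nlinarith
    refine (W_le_V hρ X).trans ?_
    unfold V
    apply Real.exp_le_exp.2
    have e : m/ρ*(ρ*X+L*ρ) = m*(X+L) := by field_simp
    rw [e]
    have e1 := Real.add_one_le_exp (a*(-X-L))
    have e2 : Real.exp (-(a*X)) = Real.exp (a*L) * Real.exp (a*(-X-L)) := by
      rw [← Real.exp_add]; congr 1; ring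
    have e3 : m * (-X-L) ≤ Real.exp (-(a*X))/a/2 := by
      rw [div_div, le_div_iff₀ (by positivity), e2]
      have h0 : 0 ≤ a*(-X-L) := mul_nonneg ha.le (by linarith)
      have := mul_le_mul hL (show a*(-X-L) ≤ Real.exp (a*(-X-L)) by linarith) h0 (Real.exp_pos _).le
      nlinarith
    rw [neg_div]; linarith
  · rw [Real.exp_zero]
    exact (W_le_V hρ X).trans (V_le_one ha X)
  · refine (W_le_exp ha X).trans ?_
    apply Real.exp_le_exp.2
    have := le_max_left X 0
    nlinarith [mul_pos hL0 hρ]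

end FPE

/-- existence of a continuous solution of equation (E) in X_{L,ρ}
(Theorem 3.1 of the paper). -/
theorem fixed_point_existence
    (K : ℝ → ℝ → ℝ) (γ a K0 δ m L0 ρ0 : ℝ)
    (hK : KernelHyp K γ a K0 δ) (hP : ParamHyp a m L0 ρ0) :
    ∃ Lbar : ℝ, L0 ≤ Lbar ∧ ∃ ρbar : ℝ → ℝ,
      (∀ L : ℝ, Lbar < L → ρbar L ∈ Ioo 0 ρ0) ∧
      ∀ L : ℝ, Lbar < L → ∀ ρ ∈ Ioo 0 (ρbar L),
        ∃ h : ℝ → ℝ, memX a m L ρ h ∧ Continuous h ∧ solvesE K a ρ h := by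
  have H := FPE.KH_of hK
  obtain ⟨hm, hL0, hρ0, hρ01⟩ := hP
  have ha := H.ha
  have hm1 : 1 < m := by
    have := (le_max_left (a+1) (3*a)).trans_lt hm; linarith
  set D := FPE.C4 a * (4 * (2 * FPE.C2 (K0+1) δ)) with hD
  have hD0 : 0 < D := by
    have := FPE.C4_pos ha
    have := FPE.C2_pos (δ := δ) H.hC
    positivity
  refine ⟨L0, le_rfl, fun _ => min (ρ0/2) (min (1/4) (min (a^2/5) (1/(10*D)))), fun L _ => ⟨?_, ?_⟩, ?_⟩
  · have : 0 < ρ0/2 := by linarith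
    have : 0 < a^2/5 := by positivity
    have : 0 < 1/(10*D) := by positivity
    simp only [lt_min_iff]
    refine ⟨by assumption, by norm_num, by assumption, by assumption⟩
  · exact (min_le_left _ _).trans_lt (by linarith)
  · rintro L hL ρ ⟨hρ, hρ'⟩
    simp only [lt_min_iff] at hρ'
    obtain ⟨-, h2, h3, h4⟩ := hρ'
    have he : FPE.eta a (K0+1) δ ρ ≤ 1/10 := by
      have e : FPE.eta a (K0+1) δ ρ = ρ * D := by rw [hD]; unfold FPE.eta; ring
      rw [e]
      rw [lt_div_iff₀ (by positivity)] at h4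
      linarith
    obtain ⟨g, hgc, hgb, hg1, hg2, hg3⟩ := FPE.exists_g H hρ h2.le h3.le he
    have hlog : Real.log (4*m) < a * L := by
      have : (1/a) * Real.log (4*m) < L := hL0.trans hL
      rw [one_div, inv_mul_lt_iff₀ ha] at this
      exact this
    have hLe : 4*m ≤ Real.exp (a*L) := by
      rw [← Real.exp_log (show 0 < 4*m by linarith)]
      exact Real.exp_le_exp.2 hlog.le
    have hLp : 0 < L := by
      have : 0 < Real.log (4*m) := Real.log_pos (by linarith)
      exact pos_of_mul_pos_right (this.trans hlog) ha.le
    have hc : Continuous (fun x => g (x/ρ)) := hgc.comp (continuous_id.div_const ρ)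
    refine ⟨fun x => g (x/ρ), ⟨hc.continuousOn, ?_, ?_, fun x => ?_⟩, hc, FPE.solves hρ hg3⟩
    · rw [FPE.subst_int ρ 0 hρ, ← hg1]
      congr 2; ext s; congr 1; field_simp; ring
    · rw [FPE.subst_int ρ 0 hρ, ← hg2, ← mul_assoc, one_div_mul_cancel hρ.ne', one_mul]
      congr 1; ext s
      unfold FPE.qq
      dsimp only
      rw [show (0 + ρ*s)/ρ = s by field_simp; ring, show -(a/ρ)*(0+ρ*s) = -(a*s) by field_simp; ring]
    · have := FPE.W_omega ha hρ (by linarith) hLp hLe x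
      have := hgb (x/ρ)
      dsimp only
      linarith
end

section
/- There exists a constant C > 0, depending only on K0, a, δ, m, L0, ρ0, such that for every L ≥ L0, every ρ ∈ (0,ρ0), and every measurable h : ℝ → ℝ with |h(x)| ≤ 2·e^{ω(x)} for all x ∈ ℝ, one has (1/ρ)·∫_ℝ e^{−(a/ρ)y}·|h(y)| dy ≤ C·e^{aL} and (1/ρ)·∫_ℝ e^{((δ−a)/ρ)y}·|h(y)| dy ≤ C·e^{aL}. -/
open Set MeasureTheory Filter

theorem aux_est (a b m L ρ : ℝ) (hb : 0 < b) (hba : b ≤ a) (hm : a + 1 < m) (hL : 0 < L)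
    (hρ : 0 < ρ) (h : ℝ → ℝ) (hh : ∀ x : ℝ, |h x| ≤ 2 * Real.exp (omegaFn m L ρ x)) :
    (1/ρ) * (∫ y : ℝ, Real.exp (-(b/ρ)*y) * |h y|) ≤ 2 * (1 + 1/b) * Real.exp (a*L) := by
  have hc1 : 0 < (m-b)/ρ := div_pos (by linarith) hρ
  have hc2 : -(b/ρ) < 0 := by have := div_pos hb hρ; linarith
  have hLρ : 0 < L*ρ := mul_pos hL hρ
  set f1 : ℝ → ℝ := fun y => 2 * Real.exp (m*L) * Real.exp ((m-b)/ρ*y) with hf1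
  set f2 : ℝ → ℝ := fun y => 2 * Real.exp (-(b/ρ)*y) with hf2
  have i1 : IntegrableOn f1 (Iic (-(L*ρ))) := (integrableOn_exp_mul_Iic hc1 _).const_mul _
  have i2 : IntegrableOn f2 (Ioi (-(L*ρ))) := (integrableOn_exp_mul_Ioi hc2 _).const_mul _
  have j1 := (integrable_indicator_iff measurableSet_Iic).2 i1
  have j2 := (integrable_indicator_iff measurableSet_Ioi).2 i2
  have key : (∫ y : ℝ, Real.exp (-(b/ρ)*y) * |h y|) ≤
      ∫ y, ((Iic (-(L*ρ))).indicator f1 y + (Ioi (-(L*ρ))).indicator f2 y) := by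
    apply integral_mono_of_nonneg
    · exact Eventually.of_forall fun y => by positivity
    · exact j1.add j2
    · refine Eventually.of_forall fun y => ?_
      have h1 := mul_le_mul_of_nonneg_left (hh y) (Real.exp_pos (-(b/ρ)*y)).le
      refine h1.trans ?_
      by_cases hy : y ≤ -(L*ρ)
      · have e : m*L + (m-b)/ρ*y = -(b/ρ)*y + m/ρ*(y+L*ρ) := by field_simp; ring
        have hn : ¬ (-(L*ρ) < y) := not_lt.2 hy
        simp only [omegaFn, hy, hn, if_true, indicator, mem_Iic, mem_Ioi, if_false, hf1, add_zero]
        rw [mul_assoc, ← Real.exp_add, e, Real.exp_add]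
        apply le_of_eq; ring
      · have hn : -(L*ρ) < y := not_le.1 hy
        simp only [indicator, mem_Iic, mem_Ioi, hy, hn, if_true, if_false, hf2, zero_add]
        have : Real.exp (omegaFn m L ρ y) ≤ 1 := by
          rw [Real.exp_le_one_iff]
          unfold omegaFn
          rw [if_neg hy]
          split_ifs <;> linarith
        nlinarith [Real.exp_pos (-(b/ρ)*y)]
  rw [integral_add j1 j2, integral_indicator measurableSet_Iic,
    integral_indicator measurableSet_Ioi] at key
  simp only [hf1, hf2] at key
  rw [integral_const_mul, integral_const_mul, integral_exp_mul_Iic hc1,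
    integral_exp_mul_Ioi hc2] at key
  have e1 : Real.exp ((m-b)/ρ * -(L*ρ)) = Real.exp (b*L) / Real.exp (m*L) := by
    rw [← Real.exp_sub]; congr 1; field_simp; ring
  have e2 : Real.exp (-(b/ρ) * -(L*ρ)) = Real.exp (b*L) := by
    congr 1; field_simp
  rw [e1, e2] at key
  have hmb : 0 < m - b := by linarith
  have e3 : 2 * Real.exp (m*L) * (Real.exp (b*L) / Real.exp (m*L) / ((m-b)/ρ)) +
      2 * (-Real.exp (b*L) / -(b/ρ)) = ρ * (2 * (1/(m-b) + 1/b) * Real.exp (b*L)) := by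
    have := (Real.exp_pos (m*L)).ne'
    field_simp
  rw [e3] at key
  have h2 : 1/(m-b) ≤ 1 := by rw [div_le_one hmb]; linarith
  have h3 : Real.exp (b*L) ≤ Real.exp (a*L) := by gcongr
  calc _ ≤ (1/ρ) * (ρ * (2 * (1/(m-b) + 1/b) * Real.exp (b*L))) := by gcongr
    _ = 2 * (1/(m-b) + 1/b) * Real.exp (b*L) := by field_simp
    _ ≤ _ := by gcongr

/-- uniform integral estimates (Lemma 4.1 of the paper). -/
theorem uniform_integral_estimates
    (a K0 δ m L0 ρ0 : ℝ) (ha : 0 < a) (hK0 : 0 < K0)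
    (hδ : δ ∈ Ioo 0 (min 1 a)) (hP : ParamHyp a m L0 ρ0) :
    ∃ C : ℝ, 0 < C ∧ ∀ L : ℝ, L0 ≤ L → ∀ ρ ∈ Ioo (0:ℝ) ρ0, ∀ h : ℝ → ℝ,
      Measurable h → (∀ x : ℝ, |h x| ≤ 2 * Real.exp (omegaFn m L ρ x)) →
      (1/ρ) * (∫ y : ℝ, Real.exp (-(a/ρ)*y) * |h y|) ≤ C * Real.exp (a*L) ∧
      (1/ρ) * (∫ y : ℝ, Real.exp ((δ-a)/ρ*y) * |h y|) ≤ C * Real.exp (a*L) := by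
  obtain ⟨hm, hL0, -⟩ := hP
  obtain ⟨hδ0, hδ1⟩ := hδ
  have hδa : δ < a := lt_of_lt_of_le hδ1 (min_le_right _ _)
  have hm1 : a + 1 < m := lt_of_le_of_lt (le_max_left _ _) hm
  have hb : 0 < a - δ := by linarith
  have hlog : 0 < (1/a) * Real.log (4*m) :=
    mul_pos (by positivity) (Real.log_pos (by linarith))
  refine ⟨2 * (1 + 1/(a-δ)), by positivity, fun L hL ρ hρ h _ hh => ?_⟩
  have hLp : 0 < L := by linarith
  constructor
  · refine (aux_est a a m L ρ ha le_rfl hm1 hLp hρ.1 h hh).trans ?_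
    have : 1/a ≤ 1/(a-δ) := one_div_le_one_div_of_le hb (by linarith)
    gcongr
  · have := aux_est a (a-δ) m L ρ hb (by linarith) hm1 hLp hρ.1 h hh
    have e : (δ-a)/ρ = -((a-δ)/ρ) := by ring
    rw [e]; exact this
end

section
/- There exists a constant c0 > 0, depending only on K0, a, δ, and m, with the following property: for every L ≥ L0 and ρ ∈ (0,ρ0) with ρ·e^{(2a+2)L} < c0, and for every h ∈ X_{L,ρ}, one has |Q[h](y) − 1| ≤ 1/2 for all y < Lρ. -/
open Set MeasureTheory Filter

theorem aux_right (k c : ℝ) (hk : 0 < k) :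
    Integrable ((Ioi c).indicator fun z : ℝ => Real.exp (-k*(z-c))) ∧
    ∫ z, (Ioi c).indicator (fun z : ℝ => Real.exp (-k*(z-c))) z = 1/k := by
  have e : (fun z : ℝ => Real.exp (-k*(z-c))) = fun z => Real.exp (k*c) * Real.exp (-k*z) := by
    funext z; rw [← Real.exp_add]; ring_nf
  have hk' : -k < 0 := by linarith
  rw [integral_indicator measurableSet_Ioi, integrable_indicator_iff measurableSet_Ioi, e]
  refine ⟨(integrableOn_exp_mul_Ioi hk' c).const_mul _, ?_⟩
  rw [integral_const_mul, integral_exp_mul_Ioi hk']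
  have : Real.exp (k*c) * Real.exp (-k*c) = 1 := by rw [← Real.exp_add]; simp
  rw [neg_div_neg_eq, ← mul_div_assoc, this]

theorem aux_left (k c : ℝ) (hk : 0 < k) :
    Integrable ((Iic c).indicator fun z : ℝ => Real.exp (k*(z-c))) ∧
    ∫ z, (Iic c).indicator (fun z : ℝ => Real.exp (k*(z-c))) z = 1/k := by
  have e : (fun z : ℝ => Real.exp (k*(z-c))) = fun z => Real.exp (-k*c) * Real.exp (k*z) := by
    funext z; rw [← Real.exp_add]; ring_nf
  rw [integral_indicator measurableSet_Iic, integrable_indicator_iff measurableSet_Iic, e]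
  refine ⟨(integrableOn_exp_mul_Iic hk c).const_mul _, ?_⟩
  rw [integral_const_mul, integral_exp_mul_Iic hk]
  have : Real.exp (-k*c) * Real.exp (k*c) = 1 := by rw [← Real.exp_add]; simp
  rw [← mul_div_assoc, this]

theorem aux_small {K : ℝ → ℝ → ℝ} {γ a K0 δ : ℝ} (H : KernelHyp K γ a K0 δ) (t : ℝ)
    (ht : t ≤ 0) : |Real.exp (a*t) * K (Real.exp t) 1 - 1| ≤ K0 * Real.exp (δ*t) := by
  obtain ⟨-, -, -, -, -, -, -, -, h⟩ := H
  have h1 : Real.exp t ≤ 1 := Real.exp_le_one_iff.2 ht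
  have := h (Real.exp t) ⟨Real.exp_pos t, by linarith⟩
  rw [← Real.exp_mul, ← Real.exp_mul] at this
  rwa [mul_comm a, mul_comm δ]

theorem aux_big {K : ℝ → ℝ → ℝ} {γ a K0 δ : ℝ} (H : KernelHyp K γ a K0 δ) (t : ℝ)
    (ht : 0 ≤ t) : |Real.exp (a*t) * K (Real.exp t) 1 - 1| ≤ (1+K0) * Real.exp ((a+1)*t) := by
  have hs := aux_small H (-t) (by linarith)
  obtain ⟨hγ, ha, -, hpos, hsym, hhom, hK0, hδ, -⟩ := H
  have hδ0 : 0 < δ := hδ.1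
  have ha0 : 0 < a := by linarith
  have e1 : K (Real.exp t) 1 = Real.exp (γ*t) * K (Real.exp (-t)) 1 := by
    have := hhom 1 (Real.exp (-t)) (Real.exp t) one_pos (Real.exp_pos _) (Real.exp_pos _)
    rw [← Real.exp_add, ← Real.exp_mul, hsym 1 _ one_pos (Real.exp_pos _)] at this
    simpa [mul_comm] using this
  have e2 : Real.exp (a*t) * K (Real.exp t) 1
      = Real.exp ((a+1)*t) * (Real.exp (a*(-t)) * K (Real.exp (-t)) 1) := by
    rw [e1, ← mul_assoc, ← mul_assoc, ← Real.exp_add, ← Real.exp_add]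
    congr 2
    rw [ha]; ring
  have h0 : 0 ≤ Real.exp (a*t) * K (Real.exp t) 1 :=
    mul_nonneg (Real.exp_pos _).le (hpos _ _ (Real.exp_pos _) one_pos)
  have h1 : Real.exp (δ*(-t)) ≤ 1 := Real.exp_le_one_iff.2 (by nlinarith)
  have h2 : 1 ≤ Real.exp ((a+1)*t) := Real.one_le_exp (by positivity)
  have h3 : Real.exp (a*(-t)) * K (Real.exp (-t)) 1 ≤ 1 + K0 := by
    have := (abs_le.1 hs).2
    nlinarith
  have h4 : Real.exp (a*t) * K (Real.exp t) 1 ≤ (1+K0) * Real.exp ((a+1)*t) := by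
    rw [e2, mul_comm]
    exact mul_le_mul_of_nonneg_right h3 (Real.exp_pos _).le
  rw [abs_le]
  constructor
  · nlinarith
  · linarith

theorem aux_bound {K : ℝ → ℝ → ℝ} {γ a K0 δ m L ρ y : ℝ} {h : ℝ → ℝ}
    (H : KernelHyp K γ a K0 δ) (hm0 : 0 < m) (hL : 0 < L) (hρ : 0 < ρ)
    (hh : ∀ x : ℝ, |h x| ≤ 2 * Real.exp (omegaFn m L ρ x)) (hy : y < L*ρ) (z : ℝ) :
    ‖(Real.exp (a/ρ*(y-z)) * K (Real.exp ((y-z)/ρ)) 1 - 1) * h z‖ ≤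
      2*K0 * (Ioi y).indicator (fun z : ℝ => Real.exp (-(δ/ρ)*(z-y))) z +
      2*(1+K0)*Real.exp ((2*a+2)*L) *
        ((Ioi (-(L*ρ))).indicator (fun z : ℝ => Real.exp (-((a+1)/ρ)*(z- -(L*ρ)))) z +
         (Iic (-(L*ρ))).indicator (fun z : ℝ => Real.exp ((m-a-1)/ρ*(z- -(L*ρ)))) z) := by
  have hK0 : 0 < K0 := H.2.2.2.2.2.2.1
  have ha0 : 0 < a := by linarith [H.1, H.2.1]
  have hLρ : 0 < L*ρ := by positivity
  have hn1 : 0 ≤ (Ioi y).indicator (fun z : ℝ => Real.exp (-(δ/ρ)*(z-y))) z :=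
    indicator_nonneg (fun _ _ => (Real.exp_pos _).le) _
  have hn2 : 0 ≤ (Ioi (-(L*ρ))).indicator (fun z : ℝ => Real.exp (-((a+1)/ρ)*(z- -(L*ρ)))) z :=
    indicator_nonneg (fun _ _ => (Real.exp_pos _).le) _
  have hn3 : 0 ≤ (Iic (-(L*ρ))).indicator (fun z : ℝ => Real.exp ((m-a-1)/ρ*(z- -(L*ρ)))) z :=
    indicator_nonneg (fun _ _ => (Real.exp_pos _).le) _
  have e : a/ρ*(y-z) = a*((y-z)/ρ) := by ring
  rw [Real.norm_eq_abs, abs_mul, e]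
  rcases lt_or_ge y z with hz | hz
  · have hs := aux_small H ((y-z)/ρ) (div_nonpos_of_nonpos_of_nonneg (by linarith) hρ.le)
    have hE : (1:ℝ) ≤ Real.exp ((2*a+2)*L) := Real.one_le_exp (by positivity)
    have hω : |h z| ≤ 2 := by
      have h0 : omegaFn m L ρ z ≤ 0 := by
        unfold omegaFn
        split_ifs with h1 h2
        · exact mul_nonpos_of_nonneg_of_nonpos (by positivity) (by linarith)
        · exact le_refl _
        · linarith
      have := Real.exp_le_one_iff.2 h0
      linarith [hh z]
    have hi : (Ioi y).indicator (fun z : ℝ => Real.exp (-(δ/ρ)*(z-y))) z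
        = Real.exp (δ*((y-z)/ρ)) := by
      rw [indicator_of_mem (show z ∈ Ioi y from hz)]
      congr 1; ring
    rw [hi]
    have hp : 0 < K0 * Real.exp (δ*((y-z)/ρ)) := by positivity
    have h1 := mul_le_mul hs hω (abs_nonneg _) hp.le
    have h2 := mul_nonneg (by positivity : 0 ≤ 2*(1+K0)*Real.exp ((2*a+2)*L)) (add_nonneg hn2 hn3)
    linarith
  · have hb := aux_big H ((y-z)/ρ) (div_nonneg (by linarith) hρ.le)
    have hyL : y/ρ ≤ L := by rw [div_le_iff₀ hρ]; exact hy.le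
    have key : |h z| * Real.exp ((a+1)*((y-z)/ρ)) ≤ 2 * Real.exp ((2*a+2)*L) *
        ((Ioi (-(L*ρ))).indicator (fun z : ℝ => Real.exp (-((a+1)/ρ)*(z- -(L*ρ)))) z +
         (Iic (-(L*ρ))).indicator (fun z : ℝ => Real.exp ((m-a-1)/ρ*(z- -(L*ρ)))) z) := by
      refine (mul_le_mul_of_nonneg_right (hh z) (Real.exp_pos _).le).trans ?_
      rw [mul_assoc, mul_assoc, ← Real.exp_add]
      refine mul_le_mul_of_nonneg_left ?_ (by norm_num)
      have hm1 : (a+1)*(y/ρ) ≤ (a+1)*L := mul_le_mul_of_nonneg_left hyL (by linarith)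
      have hL1 : L*ρ/ρ = L := by field_simp
      rcases lt_or_ge (-(L*ρ)) z with h1 | h1
      · rw [indicator_of_mem (show z ∈ Ioi (-(L*ρ)) from h1),
          indicator_of_notMem (by simpa using h1), add_zero, ← Real.exp_add]
        have : omegaFn m L ρ z = 0 := by
          unfold omegaFn
          rw [if_neg (by linarith), if_pos (by linarith)]
        rw [this, Real.exp_le_exp]
        have e1 : -((a+1)/ρ)*(z- -(L*ρ)) = -((a+1)*(z/ρ)) - (a+1)*(L*ρ/ρ) := by ring
        have e2 : (a+1)*((y-z)/ρ) = (a+1)*(y/ρ) - (a+1)*(z/ρ) := by ring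
        rw [e1, e2, hL1]
        linarith
      · rw [indicator_of_mem (show z ∈ Iic (-(L*ρ)) from h1),
          indicator_of_notMem (by simpa using h1), zero_add, ← Real.exp_add]
        have : omegaFn m L ρ z = m*(z/ρ) + m*(L*ρ/ρ) := by
          unfold omegaFn
          rw [if_pos h1]; ring
        rw [this, Real.exp_le_exp]
        have e1 : (m-a-1)/ρ*(z- -(L*ρ)) = (m-a-1)*(z/ρ) + (m-a-1)*(L*ρ/ρ) := by ring
        have e2 : (a+1)*((y-z)/ρ) = (a+1)*(y/ρ) - (a+1)*(z/ρ) := by ring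
        rw [e1, e2, hL1]
        linarith
    have h1 := mul_le_mul_of_nonneg_right hb (abs_nonneg (h z))
    have h2 := mul_le_mul_of_nonneg_left key (by linarith : 0 ≤ 1 + K0)
    have h3 := mul_nonneg (by linarith : 0 ≤ 2*K0) hn1
    refine h1.trans ?_
    linarith

/-- Q[h] is uniformly close to 1 (Lemma 4.2 of the paper). -/
theorem Q_close_to_one
    (γ a K0 δ m : ℝ) (hγ : γ < 1) (ha : a = 1 - γ)
    (hK0 : 0 < K0) (hδ : δ ∈ Ioo 0 (min 1 a)) (hm : max (a+1) (3*a) < m) :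
    ∃ c0 : ℝ, 0 < c0 ∧
      ∀ K : ℝ → ℝ → ℝ, KernelHyp K γ a K0 δ →
      ∀ L0 ρ0 : ℝ, ParamHyp a m L0 ρ0 →
      ∀ L : ℝ, L0 ≤ L → ∀ ρ ∈ Ioo (0:ℝ) ρ0,
        ρ * Real.exp ((2*a+2)*L) < c0 →
        ∀ h : ℝ → ℝ, memX a m L ρ h →
        ∀ y : ℝ, y < L*ρ → |Qfun K a ρ h y - 1| ≤ 1/2 := by
  have ha0 : 0 < a := by linarith
  have hδ0 : 0 < δ := hδ.1
  have hm1 : 0 < m - a - 1 := by linarith [le_max_left (a+1) (3*a)]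
  set C : ℝ := 2*K0/δ + 2*(1+K0)*(1/(a+1) + 1/(m-a-1)) with hC
  have hC0 : 0 < C := by positivity
  refine ⟨1/(2*C), by positivity, ?_⟩
  intro K H L0 ρ0 hP L hL0 ρ hρ' hsmall h hX y hy
  have hρ : 0 < ρ := hρ'.1
  obtain ⟨hcont, hint, -, hh⟩ := hX
  have hL : 0 < L := by
    have h1 : 0 < (1/a) * Real.log (4*m) := mul_pos (by positivity) (Real.log_pos (by linarith))
    linarith [hP.2.1]
  have hI : Integrable h := by
    by_contra hc
    rw [integral_undef hc] at hint
    exact zero_ne_one hint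
  have hKc : Continuous fun z : ℝ => Real.exp (a/ρ*(y-z)) * K (Real.exp ((y-z)/ρ)) 1 := by
    refine Continuous.mul (by fun_prop) ?_
    exact H.2.2.1.comp_continuous (f := fun z : ℝ => (Real.exp ((y-z)/ρ), (1:ℝ)))
      (by fun_prop) (fun z => ⟨Real.exp_pos _, (one_pos : (0:ℝ) < 1)⟩)
  obtain ⟨i1, v1⟩ := aux_right (δ/ρ) y (by positivity)
  obtain ⟨i2, v2⟩ := aux_right ((a+1)/ρ) (-(L*ρ)) (by positivity)
  obtain ⟨i3, v3⟩ := aux_left ((m-a-1)/ρ) (-(L*ρ)) (by positivity)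
  have hB := aux_bound H (by linarith : 0 < m) hL hρ hh hy
  have hG := (i1.const_mul (2*K0)).add ((i2.add i3).const_mul (2*(1+K0)*Real.exp ((2*a+2)*L)))
  have hF : Integrable fun z : ℝ =>
      (Real.exp (a/ρ*(y-z)) * K (Real.exp ((y-z)/ρ)) 1 - 1) * h z :=
    hG.mono' ((hKc.sub continuous_const).aestronglyMeasurable.mul hI.aestronglyMeasurable)
      (Eventually.of_forall hB)
  have hQ : Qfun K a ρ h y - 1 =
      ∫ z : ℝ, (Real.exp (a/ρ*(y-z)) * K (Real.exp ((y-z)/ρ)) 1 - 1) * h z := by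
    have hs := integral_add hF hI
    rw [hint] at hs
    rw [sub_eq_iff_eq_add, ← hs]
    unfold Qfun
    congr 1; funext z; ring
  have hN := norm_integral_le_of_norm_le hG (Eventually.of_forall hB)
  rw [← hQ, Real.norm_eq_abs] at hN
  have hV := integral_add (i1.const_mul (2*K0))
    ((i2.add i3).const_mul (2*(1+K0)*Real.exp ((2*a+2)*L)))
  rw [integral_const_mul, integral_const_mul, integral_add' i2 i3, v1, v2, v3] at hV
  refine (hN.trans (le_of_eq hV)).trans ?_
  have hE : (1:ℝ) ≤ Real.exp ((2*a+2)*L) := Real.one_le_exp (by positivity)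
  have h1 : 2*K0*(1/(δ/ρ)) ≤ 2*K0/δ * (ρ * Real.exp ((2*a+2)*L)) := by
    have : 2*K0*(1/(δ/ρ)) = 2*K0/δ * (ρ * 1) := by field_simp
    rw [this]; gcongr
  have h2 : 2*(1+K0)*Real.exp ((2*a+2)*L) * (1/((a+1)/ρ) + 1/((m-a-1)/ρ))
      = 2*(1+K0)*(1/(a+1) + 1/(m-a-1)) * (ρ * Real.exp ((2*a+2)*L)) := by
    rw [one_div_div, one_div_div]; ring
  have h3 : C * (ρ * Real.exp ((2*a+2)*L)) ≤ C * (1/(2*C)) :=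
    mul_le_mul_of_nonneg_left hsmall.le hC0.le
  have h4 : C * (1/(2*C)) = 1/2 := by field_simp
  rw [h4, hC, add_mul] at h3
  linarith
end

section
/- There exists a constant C > 0, depending only on K0, a, δ, and m, such that for every L ≥ L0, every ρ ∈ (0,ρ0), and every h ∈ X_{L,ρ}: |Q[h](y) − 1| ≤ C·ρ for all y ≤ −Lρ, and |Q[h](y) − 1| ≤ C·ρ·(1 + L + e^{(2a+2)L}) for all y with −Lρ < y < Lρ. -/
open Set MeasureTheory Filter

lemma expabs_integral (c : ℝ) (hc : 0 < c) (b : ℝ) :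
    (∫ z : ℝ, Real.exp (-c * |z - b|)) = 2 / c := by
  have h1 := integral_sub_right_eq_self (μ := volume) (fun z : ℝ => Real.exp (-c * |z|)) b
  rw [h1]
  have h2 := integral_comp_abs (f := fun z : ℝ => Real.exp (-c * z))
  rw [h2, integral_exp_mul_Ioi (by linarith)]
  simp
  field_simp

lemma expabs_integrable (c : ℝ) (hc : 0 < c) (b : ℝ) :
    Integrable (fun z : ℝ => Real.exp (-c * |z - b|)) := by
  apply Integrable.of_integral_ne_zero
  rw [expabs_integral c hc b]
  positivity

lemma kernel_low {K : ℝ → ℝ → ℝ} {γ a K0 δ : ℝ} (hK : KernelHyp K γ a K0 δ) (t : ℝ) (ht : t ≤ 0) :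
    |Real.exp (a * t) * K (Real.exp t) 1 - 1| ≤ K0 * Real.exp (δ * t) := by
  obtain ⟨-, -, -, -, -, -, -, -, hb⟩ := hK
  have h := hb (Real.exp t) ⟨Real.exp_pos t, by
    have := Real.exp_le_one_iff.2 ht
    linarith⟩
  rw [← Real.exp_mul, ← Real.exp_mul, mul_comm t a, mul_comm t δ] at h
  exact h

lemma kernel_high {K : ℝ → ℝ → ℝ} {γ a K0 δ : ℝ} (hK : KernelHyp K γ a K0 δ) (t : ℝ) (ht : 0 ≤ t) :
    |Real.exp (a * t) * K (Real.exp t) 1 - 1| ≤ (2 + K0) * Real.exp ((1 + a) * t) := by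
  have hl := kernel_low hK (-t) (by linarith)
  obtain ⟨hγ, haγ, -, hpos, hsym, hhom, hK0, hδ, -⟩ := hK
  have hδ0 : 0 < δ := hδ.1
  have hδ2 : δ < a := hδ.2.trans_le (min_le_right _ _)
  have e1 : K (Real.exp t) 1 = Real.exp (γ * t) * K (Real.exp (-t)) 1 := by
    have h := hhom 1 (Real.exp (-t)) (Real.exp t) one_pos (Real.exp_pos _) (Real.exp_pos _)
    rw [← Real.exp_add, add_neg_cancel, Real.exp_zero, mul_one, ← Real.exp_mul,
      hsym 1 _ one_pos (Real.exp_pos _), mul_comm t γ] at h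
    exact h
  have e2 : Real.exp (a * t) * K (Real.exp t) 1
      = Real.exp ((1 + a) * t) * (Real.exp (a * -t) * K (Real.exp (-t)) 1) := by
    rw [e1, ← mul_assoc, ← mul_assoc, ← Real.exp_add, ← Real.exp_add]
    congr 2
    rw [haγ]; ring
  have h3 : Real.exp (δ * -t) ≤ 1 := Real.exp_le_one_iff.2 (by nlinarith)
  have h4 := (abs_le.1 hl).2
  have h5 : Real.exp (a * -t) * K (Real.exp (-t)) 1 ≤ 1 + K0 := by nlinarith
  have h6 : 0 ≤ Real.exp (a * -t) * K (Real.exp (-t)) 1 :=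
    mul_nonneg (Real.exp_pos _).le (hpos _ _ (Real.exp_pos _) one_pos)
  have h7 : 1 ≤ Real.exp ((1 + a) * t) := Real.one_le_exp (by nlinarith)
  rw [e2, abs_le]
  constructor <;> nlinarith

lemma weight_bound {a m L ρ c y z : ℝ} (hρ : 0 < ρ) (ha : 0 < a) (hL : 0 < L)
    (hc1 : c ≤ 1 + a) (hc2 : c ≤ m - 1 - a) :
    Real.exp ((1 + a) * ((y - z) / ρ)) * Real.exp (omegaFn m L ρ z)
      ≤ Real.exp ((1 + a) * ((y + L * ρ) / ρ)) * Real.exp (-(c / ρ) * |z - -(L * ρ)|) := by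
  rw [← Real.exp_add, ← Real.exp_add, Real.exp_le_exp]
  have hLρ : 0 < L * ρ := by positivity
  unfold omegaFn
  have key : ∀ w : ℝ, (1 + a) * (-(z + L * ρ)) + ρ * w ≤ - (c * |z - -(L * ρ)|) →
      (1 + a) * ((y - z) / ρ) + w
        ≤ (1 + a) * ((y + L * ρ) / ρ) + -(c / ρ) * |z - -(L * ρ)| := by
    intro w hw
    have : (1 + a) * ((y + L * ρ) / ρ) + -(c / ρ) * |z - -(L * ρ)|
        - ((1 + a) * ((y - z) / ρ) + w)
        = (- (c * |z - -(L * ρ)|) - ((1 + a) * (-(z + L * ρ)) + ρ * w)) / ρ := by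
      field_simp; ring
    have h2 : 0 ≤ (- (c * |z - -(L * ρ)|) - ((1 + a) * (-(z + L * ρ)) + ρ * w)) / ρ :=
      div_nonneg (by linarith) hρ.le
    linarith
  apply key
  split_ifs with h1 h2
  · rw [abs_of_nonpos (by linarith)]
    have : ρ * (m / ρ * (z + L * ρ)) = m * (z + L * ρ) := by field_simp
    rw [this]
    nlinarith
  · rw [abs_of_nonneg (by linarith)]
    nlinarith
  · rw [abs_of_nonneg (by linarith)]
    have h3 : 0 ≤ ρ * (1 / 2 * (z - L * ρ)) := mul_nonneg hρ.le (by linarith)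
    nlinarith

lemma weight_le_one {m L ρ z : ℝ} (hρ : 0 < ρ) (hm : 0 < m) :
    Real.exp (omegaFn m L ρ z) ≤ 1 := by
  rw [Real.exp_le_one_iff]
  unfold omegaFn
  have : 0 < m / ρ := by positivity
  split_ifs with h1 h2
  · nlinarith
  · exact le_rfl
  · linarith

lemma main_bound {K : ℝ → ℝ → ℝ} {γ a K0 δ m L ρ c : ℝ} (hK : KernelHyp K γ a K0 δ)
    (hρ : 0 < ρ) (hL : 0 < L) (hm : 0 < m) (hc : 0 < c)
    (hc1 : c ≤ 1 + a) (hc2 : c ≤ m - 1 - a) {h : ℝ → ℝ} (hh : memX a m L ρ h) (y : ℝ) :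
    |Qfun K a ρ h y - 1| ≤
      ρ * (4 * K0 / δ + 4 * (2 + K0) / c * Real.exp ((1 + a) * ((y + L * ρ) / ρ))) := by
  have hlow := kernel_low hK
  have hhigh := kernel_high hK
  obtain ⟨hγ, haγ, hcont, -, -, -, hK0, hδ, -⟩ := hK
  obtain ⟨-, hint, -, hbd⟩ := hh
  have hδ0 : 0 < δ := hδ.1
  have ha : 0 < a := by linarith
  have hI : Integrable h := Integrable.of_integral_ne_zero (by rw [hint]; exact one_ne_zero)
  set E := Real.exp ((1 + a) * ((y + L * ρ) / ρ)) with hE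
  set k : ℝ → ℝ := fun z => Real.exp (a/ρ*(y-z)) * K (Real.exp ((y-z)/ρ)) 1 with hk
  have hkc : Continuous k := by
    have h1 : Continuous (fun z : ℝ => K (Real.exp ((y-z)/ρ)) 1) := by
      have : ContinuousOn ((fun p : ℝ × ℝ => K p.1 p.2) ∘
          (fun z : ℝ => (Real.exp ((y-z)/ρ), (1:ℝ)))) univ := by
        apply hcont.comp
        · fun_prop
        · intro z _
          exact ⟨Real.exp_pos _, Set.mem_Ioi.2 (zero_lt_one (α := ℝ))⟩
      exact continuousOn_univ.1 this
    have h2 : Continuous (fun z : ℝ => Real.exp (a/ρ*(y-z))) := by fun_prop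
    exact h2.mul h1
  set G : ℝ → ℝ := fun z => 2 * K0 * Real.exp (-(δ / ρ) * |z - y|)
    + 2 * (2 + K0) * E * Real.exp (-(c / ρ) * |z - -(L * ρ)|) with hG
  have hδρ : 0 < δ / ρ := by positivity
  have hcρ : 0 < c / ρ := by positivity
  have hG1 : Integrable (fun z : ℝ => 2 * K0 * Real.exp (-(δ / ρ) * |z - y|)) :=
    (expabs_integrable _ hδρ y).const_mul _
  have hG2 : Integrable (fun z : ℝ =>
      2 * (2 + K0) * E * Real.exp (-(c / ρ) * |z - -(L * ρ)|)) :=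
    (expabs_integrable _ hcρ (-(L * ρ))).const_mul _
  have hGi : Integrable G := hG1.add hG2
  have hGint : ∫ z, G z = ρ * (4 * K0 / δ + 4 * (2 + K0) / c * E) := by
    rw [hG, integral_add hG1 hG2, integral_const_mul, integral_const_mul,
      expabs_integral _ hδρ, expabs_integral _ hcρ]
    field_simp
    ring
  have hpt : ∀ z, ‖(k z - 1) * h z‖ ≤ G z := by
    intro z
    rw [Real.norm_eq_abs, abs_mul]
    have hkz : k z = Real.exp (a * ((y - z) / ρ)) * K (Real.exp ((y-z)/ρ)) 1 := by
      simp only [hk]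
      congr 2
      ring
    rw [hkz]
    have hbz := hbd z
    rcases le_total y z with hyz | hyz
    · have h1 := hlow ((y - z) / ρ) (div_nonpos_of_nonpos_of_nonneg (by linarith) hρ.le)
      have h2 : |h z| ≤ 2 := by
        have := weight_le_one (L := L) (z := z) hρ hm
        linarith
      have h3 : δ * ((y - z) / ρ) = -(δ / ρ) * |z - y| := by
        rw [abs_of_nonneg (by linarith)]; ring
      rw [h3] at h1
      calc _ ≤ (K0 * Real.exp (-(δ / ρ) * |z - y|)) * 2 :=
            mul_le_mul h1 h2 (abs_nonneg _) (by positivity)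
        _ = 2 * K0 * Real.exp (-(δ / ρ) * |z - y|) := by ring
        _ ≤ G z := by
            simp only [hG]
            have : 0 ≤ 2 * (2 + K0) * E * Real.exp (-(c / ρ) * |z - -(L * ρ)|) := by positivity
            linarith
    · have h1 := hhigh ((y - z) / ρ) (div_nonneg (by linarith) hρ.le)
      have h2 := weight_bound (y := y) (z := z) hρ ha hL hc1 hc2
      calc _ ≤ ((2 + K0) * Real.exp ((1 + a) * ((y - z) / ρ))) *
              (2 * Real.exp (omegaFn m L ρ z)) :=
            mul_le_mul h1 hbz (abs_nonneg _) (by positivity)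
        _ = 2 * (2 + K0) * (Real.exp ((1 + a) * ((y - z) / ρ)) *
              Real.exp (omegaFn m L ρ z)) := by ring
        _ ≤ 2 * (2 + K0) * (E * Real.exp (-(c / ρ) * |z - -(L * ρ)|)) := by
            apply mul_le_mul_of_nonneg_left h2 (by positivity)
        _ ≤ G z := by
            simp only [hG]
            have : 0 ≤ 2 * K0 * Real.exp (-(δ / ρ) * |z - y|) := by positivity
            linarith
  have hD : Integrable (fun z => (k z - 1) * h z) :=
    hGi.mono' (((hkc.sub continuous_const).aestronglyMeasurable).mul hI.1)
      (Eventually.of_forall hpt)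
  have hQ : Qfun K a ρ h y - 1 = ∫ z, (k z - 1) * h z := by
    have : Qfun K a ρ h y = ∫ z, ((k z - 1) * h z + h z) := by
      unfold Qfun
      congr 1
      ext z
      simp only [hk]
      ring
    rw [this, integral_add hD hI, hint]
    ring
  rw [hQ, ← hGint, ← Real.norm_eq_abs]
  exact norm_integral_le_of_norm_le hGi (Eventually.of_forall hpt)

/-- quantitative closeness of Q[h] to 1 (estimates (4.3)-(4.4) of the paper). -/
theorem Q_close_to_one_quantitative
    (γ a K0 δ m : ℝ) (hγ : γ < 1) (ha : a = 1 - γ)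
    (hK0 : 0 < K0) (hδ : δ ∈ Ioo 0 (min 1 a)) (hm : max (a+1) (3*a) < m) :
    ∃ C : ℝ, 0 < C ∧
      ∀ K : ℝ → ℝ → ℝ, KernelHyp K γ a K0 δ →
      ∀ L0 ρ0 : ℝ, ParamHyp a m L0 ρ0 →
      ∀ L : ℝ, L0 ≤ L → ∀ ρ ∈ Ioo (0:ℝ) ρ0,
        ∀ h : ℝ → ℝ, memX a m L ρ h →
        (∀ y : ℝ, y ≤ -(L*ρ) → |Qfun K a ρ h y - 1| ≤ C * ρ) ∧
        (∀ y : ℝ, -(L*ρ) < y → y < L*ρ →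
          |Qfun K a ρ h y - 1| ≤ C * ρ * (1 + L + Real.exp ((2*a+2)*L))) := by
  have ha0 : 0 < a := by linarith
  have hm1 : a + 1 < m := (le_max_left _ _).trans_lt hm
  have hδ0 : 0 < δ := hδ.1
  set c := min (1 + a) (m - 1 - a) with hcdef
  have hc : 0 < c := lt_min (by linarith) (by linarith)
  refine ⟨4 * K0 / δ + 4 * (2 + K0) / c, by positivity, ?_⟩
  intro K hK L0 ρ0 hP L hL ρ hρ h hh
  obtain ⟨-, hL0, -⟩ := hP
  have hρ0 : 0 < ρ := hρ.1
  have hLp : 0 < L := by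
    have : 0 < (1/a) * Real.log (4*m) :=
      mul_pos (by positivity) (Real.log_pos (by linarith))
    linarith
  have hA : 0 < 4 * K0 / δ := by positivity
  have hB : 0 < 4 * (2 + K0) / c := by positivity
  have key := main_bound hK hρ0 hLp (by linarith) hc (min_le_left _ _) (min_le_right _ _) hh
  constructor
  · intro y hy
    refine (key y).trans ?_
    have h1 : Real.exp ((1 + a) * ((y + L * ρ) / ρ)) ≤ 1 := by
      rw [Real.exp_le_one_iff]
      exact mul_nonpos_of_nonneg_of_nonpos (by linarith)
        (div_nonpos_of_nonpos_of_nonneg (by linarith) hρ0.le)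
    rw [mul_comm (4 * K0 / δ + 4 * (2 + K0) / c) ρ]
    apply mul_le_mul_of_nonneg_left _ hρ0.le
    nlinarith
  · intro y _ hy
    refine (key y).trans ?_
    have h1 : Real.exp ((1 + a) * ((y + L * ρ) / ρ)) ≤ Real.exp ((2*a+2)*L) := by
      rw [Real.exp_le_exp]
      have : (y + L * ρ) / ρ ≤ 2 * L := by
        rw [div_le_iff₀ hρ0]; linarith
      nlinarith
    have h2 : 0 < Real.exp ((2*a+2)*L) := Real.exp_pos _
    rw [mul_comm (4 * K0 / δ + 4 * (2 + K0) / c) ρ, mul_assoc]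
    apply mul_le_mul_of_nonneg_left _ hρ0.le
    have h3 := mul_le_mul_of_nonneg_left h1 hB.le
    have h4 := mul_pos hA h2
    have h5 := mul_pos hA hLp
    have h6 := mul_pos hB hLp
    nlinarith
end

section
/- There exists a constant C > 0, depending only on K0, a, δ, and m, such that for every L ≥ L0, every ρ ∈ (0,ρ0), every h1, h2 ∈ X_{L,ρ}, and every y < Lρ, one has |Q[h1](y) − Q[h2](y)| ≤ C·ρ·e^{(2a+2)L}·‖h1 − h2‖. -/
open Set MeasureTheory Filter

lemma aux_int (b c : ℝ) (hb : 0 < b) :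
    Integrable (fun x : ℝ => Real.exp (-b * |x - c|)) ∧ ∫ x : ℝ, Real.exp (-b * |x - c|) = 2 / b := by
  have h2 : ∫ x : ℝ, Real.exp (-b * |x - c|) = 2 / b := by
    rw [integral_sub_right_eq_self (fun x : ℝ => Real.exp (-b * |x|)) c]
    rw [integral_comp_abs (f := fun x : ℝ => Real.exp (-b * x)),
      integral_exp_mul_Ioi (by linarith)]
    simp
    field_simp
  refine ⟨?_, h2⟩
  by_contra hn
  rw [integral_undef hn] at h2
  have : 0 < 2 / b := by positivity
  linarith

lemma aux_kneg {K : ℝ → ℝ → ℝ} {γ a K0 δ : ℝ} (hK : KernelHyp K γ a K0 δ) (s : ℝ) (hs : s ≤ 0) :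
    |Real.exp (a * s) * K (Real.exp s) 1 - 1| ≤ K0 * Real.exp (δ * s) := by
  obtain ⟨_, _, _, _, _, _, _, _, hb⟩ := hK
  have h1 : Real.exp s ≤ 1 := by simpa using hs
  have := hb (Real.exp s) ⟨Real.exp_pos s, by linarith⟩
  rwa [← Real.exp_mul, ← Real.exp_mul, mul_comm s a, mul_comm s δ] at this

lemma aux_kpos {K : ℝ → ℝ → ℝ} {γ a K0 δ : ℝ} (hK : KernelHyp K γ a K0 δ) (s : ℝ) (hs : 0 ≤ s) :
    |Real.exp (a * s) * K (Real.exp s) 1 - 1| ≤ (2 + K0) * Real.exp ((1 + a) * s) := by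
  have hn := aux_kneg hK (-s) (by linarith)
  obtain ⟨hg, ha, _, hnn, hsym, hhom, hK0, hδ, _⟩ := hK
  have ha0 : 0 < a := by linarith
  have e1 : K (Real.exp s) 1 = Real.exp (γ * s) * K (Real.exp (-s)) 1 := by
    have := hhom 1 (Real.exp (-s)) (Real.exp s) one_pos (Real.exp_pos _) (Real.exp_pos _)
    rw [← Real.exp_add, ← Real.exp_mul, hsym 1 _ one_pos (Real.exp_pos _)] at this
    simpa [mul_comm s γ] using this
  have e2 : Real.exp (a * s) * K (Real.exp s) 1
      = Real.exp ((1 + a) * s) * (Real.exp (a * -s) * K (Real.exp (-s)) 1) := by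
    rw [e1, ← mul_assoc, ← mul_assoc, ← Real.exp_add, ← Real.exp_add]
    congr 2
    rw [ha]; ring
  have h3 : Real.exp (δ * -s) ≤ 1 := by
    rw [Real.exp_le_one_iff]; nlinarith [hδ.1]
  have h4 : 1 ≤ Real.exp ((1 + a) * s) := by
    rw [Real.one_le_exp_iff]; positivity
  have h5 : 0 ≤ Real.exp (a * -s) * K (Real.exp (-s)) 1 :=
    mul_nonneg (Real.exp_pos _).le (hnn _ _ (Real.exp_pos _) one_pos)
  rw [e2]
  have h6 := (abs_le.1 hn).2
  have h7 : Real.exp (a * -s) * K (Real.exp (-s)) 1 ≤ 1 + K0 := by nlinarith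
  rw [abs_le]
  constructor <;> nlinarith

lemma aux_omega {m L ρ : ℝ} (hm : 0 < m) (hρ : 0 < ρ) (x : ℝ) : omegaFn m L ρ x ≤ 0 := by
  unfold omegaFn
  split_ifs with h1 h2
  · have : 0 < m / ρ := by positivity
    nlinarith
  · exact le_rfl
  · nlinarith

lemma aux_dom {K : ℝ → ℝ → ℝ} {γ a K0 δ : ℝ} (hK : KernelHyp K γ a K0 δ) {m L ρ β y : ℝ}
    (hm : 0 < m) (hρ : 0 < ρ) (hβ1 : β ≤ 1 + a) (hβ2 : β ≤ m - (1 + a))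
    (hy : y < L * ρ) (z : ℝ) :
    |Real.exp (a / ρ * (y - z)) * K (Real.exp ((y - z) / ρ)) 1 - 1| * Real.exp (omegaFn m L ρ z)
      ≤ K0 * Real.exp (-(δ / ρ) * |z - y|)
        + (2 + K0) * Real.exp ((2 * a + 2) * L) * Real.exp (-(β / ρ) * |z - -(L * ρ)|) := by
  have ho := aux_omega (L := L) hm hρ z
  have ho' : Real.exp (omegaFn m L ρ z) ≤ 1 := Real.exp_le_one_iff.2 ho
  have hK0 : 0 < K0 := hK.2.2.2.2.2.2.1
  have ha0 : 0 < a := by linarith [hK.1, hK.2.1]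
  rw [show a / ρ * (y - z) = a * ((y - z) / ρ) by ring]
  rcases le_total y z with h | h
  · have h1 := aux_kneg hK ((y - z) / ρ) (div_nonpos_of_nonpos_of_nonneg (by linarith) hρ.le)
    have h2 : Real.exp (δ * ((y - z) / ρ)) = Real.exp (-(δ / ρ) * |z - y|) := by
      rw [abs_of_nonneg (by linarith)]; congr 1; ring
    rw [h2] at h1
    have h3 : 0 ≤ (2 + K0) * Real.exp ((2 * a + 2) * L) * Real.exp (-(β / ρ) * |z - -(L * ρ)|) := by
      positivity
    calc _ ≤ K0 * Real.exp (-(δ / ρ) * |z - y|) * 1 := by gcongr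
      _ ≤ _ := by linarith
  · have h1 := aux_kpos hK ((y - z) / ρ) (div_nonneg (by linarith) hρ.le)
    have key : (1 + a) * ((y - z) / ρ) + omegaFn m L ρ z
        ≤ (2 * a + 2) * L + -(β / ρ) * |z - -(L * ρ)| := by
      have hyz : (y - z) / ρ ≤ 2 * L - (z + L * ρ) / ρ := by
        rw [div_le_iff₀ hρ, sub_mul, div_mul_cancel₀ _ hρ.ne']; linarith
      have h2 := mul_le_mul_of_nonneg_left hyz (by linarith : 0 ≤ 1 + a)
      set t := (z + L * ρ) / ρ with ht
      by_cases hz : z ≤ -(L * ρ)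
      · have ht0 : t ≤ 0 := div_nonpos_of_nonpos_of_nonneg (by linarith) hρ.le
        have e : omegaFn m L ρ z = m * t := by
          unfold omegaFn; rw [if_pos hz, ht]; ring
        have e' : -(β / ρ) * |z - -(L * ρ)| = β * t := by
          rw [abs_of_nonpos (by linarith), ht]; ring
        rw [e, e']
        nlinarith
      · push Not at hz
        have ht0 : 0 ≤ t := div_nonneg (by linarith) hρ.le
        have e' : -(β / ρ) * |z - -(L * ρ)| = -β * t := by
          rw [abs_of_nonneg (by linarith), ht]; ring
        rw [e']
        nlinarith
    have h3 : 0 ≤ K0 * Real.exp (-(δ / ρ) * |z - y|) := by positivity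
    calc _ ≤ (2 + K0) * Real.exp ((1 + a) * ((y - z) / ρ)) * Real.exp (omegaFn m L ρ z) := by gcongr
      _ = (2 + K0) * Real.exp ((1 + a) * ((y - z) / ρ) + omegaFn m L ρ z) := by
        rw [Real.exp_add]; ring
      _ ≤ (2 + K0) * Real.exp ((2 * a + 2) * L + -(β / ρ) * |z - -(L * ρ)|) := by gcongr
      _ = (2 + K0) * Real.exp ((2 * a + 2) * L) * Real.exp (-(β / ρ) * |z - -(L * ρ)|) := by
        rw [Real.exp_add]; ring
      _ ≤ _ := by linarith

lemma aux_normX {a m L ρ : ℝ} {h1 h2 : ℝ → ℝ} (H1 : memX a m L ρ h1) (H2 : memX a m L ρ h2)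
    (z : ℝ) : |h1 z - h2 z| ≤ normX m L ρ (fun t => h1 t - h2 t) * Real.exp (omegaFn m L ρ z) := by
  have hb : BddAbove (range fun x : ℝ => |h1 x - h2 x| * Real.exp (-(omegaFn m L ρ x))) := by
    refine ⟨4, ?_⟩
    rintro _ ⟨x, rfl⟩
    have e : |h1 x - h2 x| ≤ 4 * Real.exp (omegaFn m L ρ x) := by
      have := abs_sub (h1 x) (h2 x)
      linarith [H1.2.2.2 x, H2.2.2.2 x]
    calc _ ≤ 4 * Real.exp (omegaFn m L ρ x) * Real.exp (-(omegaFn m L ρ x)) :=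
          mul_le_mul_of_nonneg_right e (Real.exp_pos _).le
      _ = 4 := by rw [mul_assoc, ← Real.exp_add]; simp
  have := le_ciSup hb z
  calc |h1 z - h2 z| = |h1 z - h2 z| * Real.exp (-(omegaFn m L ρ z)) * Real.exp (omegaFn m L ρ z) := by
        rw [mul_assoc, ← Real.exp_add]; simp
    _ ≤ _ := by
      unfold normX
      gcongr

/-- Lipschitz estimate for Q (Lemma 4.4 of the paper). -/
theorem Q_lipschitz
    (γ a K0 δ m : ℝ) (hγ : γ < 1) (ha : a = 1 - γ)
    (hK0 : 0 < K0) (hδ : δ ∈ Ioo 0 (min 1 a)) (hm : max (a+1) (3*a) < m) :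
    ∃ C : ℝ, 0 < C ∧
      ∀ K : ℝ → ℝ → ℝ, KernelHyp K γ a K0 δ →
      ∀ L0 ρ0 : ℝ, ParamHyp a m L0 ρ0 →
      ∀ L : ℝ, L0 ≤ L → ∀ ρ ∈ Ioo (0:ℝ) ρ0,
        ∀ h1 h2 : ℝ → ℝ, memX a m L ρ h1 → memX a m L ρ h2 →
        ∀ y : ℝ, y < L*ρ →
          |Qfun K a ρ h1 y - Qfun K a ρ h2 y|
            ≤ C * ρ * Real.exp ((2*a+2)*L) * normX m L ρ (fun t => h1 t - h2 t) := by
  obtain ⟨hδ0, hδ1⟩ := hδ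
  have ha0 : 0 < a := by linarith
  have hm1 : a + 1 < m := lt_of_le_of_lt (le_max_left _ _) hm
  have hm0 : 0 < m := by linarith
  set β := min (1 + a) (m - (1 + a)) with hβ
  have hβ0 : 0 < β := lt_min (by linarith) (by linarith)
  refine ⟨2 * K0 / δ + 2 * (2 + K0) / β, by positivity, ?_⟩
  intro K hK L0 ρ0 hP L hL ρ hρ h1 h2 H1 H2 y hy
  have hρ0 := hρ.1
  have hLpos : 0 ≤ L := by
    have : 0 ≤ (1 / a) * Real.log (4 * m) :=
      mul_nonneg (by positivity) (Real.log_nonneg (by linarith))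
    linarith [hP.2.1]
  set k : ℝ → ℝ := fun z => Real.exp (a / ρ * (y - z)) * K (Real.exp ((y - z) / ρ)) 1 with hk
  set N := normX m L ρ (fun t => h1 t - h2 t) with hN
  set E := Real.exp ((2 * a + 2) * L) with hE
  set G : ℝ → ℝ := fun z => K0 * Real.exp (-(δ / ρ) * |z - y|)
        + (2 + K0) * E * Real.exp (-(β / ρ) * |z - -(L * ρ)|) with hG
  have hdom : ∀ z, |k z - 1| * Real.exp (omegaFn m L ρ z) ≤ G z := fun z =>
    aux_dom hK hm0 hρ0 (min_le_left _ _) (min_le_right _ _) hy z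
  obtain ⟨i1, v1⟩ := aux_int (δ / ρ) y (by positivity)
  obtain ⟨i2, v2⟩ := aux_int (β / ρ) (-(L * ρ)) (by positivity)
  have hGi : Integrable G := (i1.const_mul _).add (i2.const_mul _)
  have hGv : ∫ z, G z = K0 * (2 / (δ / ρ)) + (2 + K0) * E * (2 / (β / ρ)) := by
    rw [hG, integral_add (i1.const_mul _) (i2.const_mul _), integral_const_mul,
      integral_const_mul, v1, v2]
  have hkc : Continuous k := by
    have : Continuous fun z : ℝ => K (Real.exp ((y - z) / ρ)) 1 := by
      have hc := hK.2.2.1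
      have := hc.comp_continuous (f := fun z : ℝ => (Real.exp ((y - z) / ρ), (1:ℝ)))
        (by fun_prop) (fun z => ⟨Real.exp_pos _, mem_Ioi.2 one_pos⟩)
      exact this
    exact (by fun_prop : Continuous fun z : ℝ => Real.exp (a / ρ * (y - z))).mul this
  have meas : ∀ h, memX a m L ρ h → Measurable h := fun h H =>
    measurable_of_continuousOn_compl_singleton (L * ρ) H.1
  have inth : ∀ h, memX a m L ρ h → Integrable h := by
    intro h H
    by_contra hn
    have := H.2.1
    rw [integral_undef hn] at this
    norm_num at this
  have intkh : ∀ h, memX a m L ρ h → Integrable (fun z => (k z - 1) * h z) := by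
    intro h H
    refine (hGi.const_mul 2).mono' ?_ (Eventually.of_forall fun z => ?_)
    · exact ((hkc.measurable.sub_const 1).mul (meas h H)).aestronglyMeasurable
    · rw [Real.norm_eq_abs, abs_mul]
      calc _ ≤ |k z - 1| * (2 * Real.exp (omegaFn m L ρ z)) := by
            gcongr; exact H.2.2.2 z
        _ ≤ 2 * G z := by linarith [hdom z]
  have hQ : ∀ h, memX a m L ρ h → Qfun K a ρ h y = (∫ z, (k z - 1) * h z) + 1 := by
    intro h H
    have hs := integral_add (intkh h H) (inth h H)
    rw [H.2.1] at hs
    rw [← hs]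
    unfold Qfun
    congr 1
    ext z
    simp only [hk]
    ring
  have hN0 : 0 ≤ N := by
    have h := (abs_nonneg _).trans (aux_normX H1 H2 0)
    exact nonneg_of_mul_nonneg_left h (Real.exp_pos _)
  have hE1 : 1 ≤ E := Real.one_le_exp (by positivity)
  rw [hQ h1 H1, hQ h2 H2, add_sub_add_right_eq_sub, ← integral_sub (intkh h1 H1) (intkh h2 H2),
    ← Real.norm_eq_abs]
  have hfin : ‖∫ z, ((k z - 1) * h1 z - (k z - 1) * h2 z)‖ ≤ ∫ z, N * G z := by
    refine norm_integral_le_of_norm_le (hGi.const_mul N) (Eventually.of_forall fun z => ?_)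
    rw [← mul_sub, Real.norm_eq_abs, abs_mul]
    calc _ ≤ |k z - 1| * (N * Real.exp (omegaFn m L ρ z)) := by
          gcongr; exact aux_normX H1 H2 z
      _ = N * (|k z - 1| * Real.exp (omegaFn m L ρ z)) := by ring
      _ ≤ N * G z := mul_le_mul_of_nonneg_left (hdom z) hN0
  refine hfin.trans ?_
  rw [integral_const_mul, hGv]
  have e1 : K0 * (2 / (δ / ρ)) = 2 * K0 / δ * ρ := by field_simp
  have e2 : (2 + K0) * E * (2 / (β / ρ)) = 2 * (2 + K0) / β * ρ * E := by field_simp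
  rw [e1, e2]
  have e3 : 2 * K0 / δ * ρ ≤ 2 * K0 / δ * ρ * E := le_mul_of_one_le_right (by positivity) hE1
  calc _ ≤ N * (2 * K0 / δ * ρ * E + 2 * (2 + K0) / β * ρ * E) := by gcongr
    _ = _ := by ring
end

section
/- Let h ∈ X_{L,ρ} and assume Q[h](y) ≥ 1/2 for all y < Lρ. Then the map x ↦ e^{−ψ_ρ[h](x) − (2m/ρ)x} is monotone non-decreasing on (−∞,−Lρ), and likewise the maps x ↦ e^{−(1/2)ψ_ρ[h](x) − (a/ρ)x} and x ↦ e^{−(1/2)ψ_ρ[h](x) − (1/ρ)x} are monotone non-decreasing on (−∞,−Lρ). -/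
open Set MeasureTheory Filter

lemma aux_kernel {K : ℝ → ℝ → ℝ} {γ a K0 δ : ℝ} (hK : KernelHyp K γ a K0 δ) (x : ℝ) (hx : 0 < x) :
    |x ^ a * K x 1| ≤ (1 + K0) * (1 + x ^ (1 + a)) := by
  obtain ⟨hγ, ha, -, hnn, hsym, hhom, hK0, hδ, hb⟩ := hK
  have small : ∀ t : ℝ, 0 < t → t ≤ 1 → t ^ a * K t 1 ≤ 1 + K0 := by
    intro t ht ht1
    have h1 := (abs_le.1 (hb t ⟨ht, by linarith⟩)).2
    have h2 : t ^ δ ≤ 1 := Real.rpow_le_one ht.le ht1 hδ.1.le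
    nlinarith
  have hp : 0 < x ^ (1 + a) := Real.rpow_pos_of_pos hx _
  rw [abs_of_nonneg (mul_nonneg (Real.rpow_pos_of_pos hx _).le (hnn x 1 hx one_pos))]
  rcases le_total x 1 with h1 | h1
  · have := small x hx h1
    nlinarith
  · have hi : 0 < x⁻¹ := inv_pos.2 hx
    have h2 := small x⁻¹ hi (inv_le_one_of_one_le₀ h1)
    have h3 := hhom 1 x⁻¹ x one_pos hi hx
    rw [mul_one, mul_inv_cancel₀ hx.ne', hsym 1 x⁻¹ one_pos hi] at h3
    have h4 : x ^ a * K x 1 = x ^ (1 + a) * (x⁻¹ ^ a * K x⁻¹ 1) := by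
      rw [h3, Real.inv_rpow hx.le, Real.rpow_add hx, show γ = 1 - a by linarith,
        Real.rpow_sub hx, Real.rpow_one]
      have : x ^ a ≠ 0 := (Real.rpow_pos_of_pos hx _).ne'
      field_simp
    rw [h4]
    nlinarith [mul_le_mul_of_nonneg_left h2 hp.le]

lemma aux_meas {h : ℝ → ℝ} {c : ℝ} (hc : ContinuousOn h {x : ℝ | x ≠ c}) : Measurable h := by
  have hms : MeasurableSet {x : ℝ | x ≠ c} := (measurableSet_singleton c).compl
  refine measurable_of_restrict_of_restrict_compl hms ?_ ?_
  · exact (continuousOn_iff_continuous_domRestrict.1 hc).measurable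
  · have : ({x : ℝ | x ≠ c}ᶜ) = {c} := by ext; simp
    have hs : Subsingleton ↑({x : ℝ | x ≠ c}ᶜ) := by rw [this]; infer_instance
    exact Subsingleton.measurable

lemma aux_int_s7 {m L ρ c : ℝ} {h : ℝ → ℝ} (hρ : 0 < ρ) (hm : Measurable h)
    (hb : ∀ x : ℝ, |h x| ≤ 2 * Real.exp (omegaFn m L ρ x)) (hc : 0 ≤ c) (hcm : c < m / ρ) :
    Integrable (fun z => Real.exp (-c * z) * |h z|) := by
  have hM : Measurable (fun z => Real.exp (-c * z) * |h z|) := by fun_prop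
  rw [← integrableOn_univ, ← Iic_union_Ioi (a := -(L*ρ))]
  refine IntegrableOn.union ?_ ?_
  · have h0 : IntegrableOn (fun z => 2 * Real.exp (m * L) * Real.exp ((m/ρ - c) * z)) (Iic (-(L*ρ))) :=
      (integrableOn_exp_mul_Iic (by linarith) _).const_mul _
    refine h0.mono' hM.aestronglyMeasurable ?_
    refine (ae_restrict_iff' measurableSet_Iic).2 (Eventually.of_forall fun z hz => ?_)
    have hz' : z ≤ -(L*ρ) := hz
    have := hb z
    rw [omegaFn, if_pos hz'] at this
    rw [Real.norm_eq_abs, abs_mul, abs_abs, abs_of_pos (Real.exp_pos _)]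
    calc _ ≤ Real.exp (-c*z) * (2 * Real.exp (m/ρ*(z+L*ρ))) := by gcongr
      _ = 2 * (Real.exp (-c*z) * Real.exp (m/ρ*(z+L*ρ))) := by ring
      _ = 2 * (Real.exp (m*L) * Real.exp ((m/ρ-c)*z)) := by
          rw [← Real.exp_add, ← Real.exp_add]; congr 2; field_simp; ring
      _ = _ := by ring
      _ ≤ _ := le_rfl
  · have h0 : IntegrableOn (fun z => 2 * Real.exp (L*ρ/2) * Real.exp (-(c+1/2) * z)) (Ioi (-(L*ρ))) :=
      (integrableOn_exp_mul_Ioi (by linarith) _).const_mul _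
    refine h0.mono' hM.aestronglyMeasurable ?_
    refine (ae_restrict_iff' measurableSet_Ioi).2 (Eventually.of_forall fun z hz => ?_)
    have hz' : ¬ z ≤ -(L*ρ) := not_le.2 hz
    have := hb z
    rw [omegaFn, if_neg hz'] at this
    have h2 : |h z| ≤ 2 * Real.exp (-(1/2)*(z-L*ρ)) := by
      refine this.trans ?_
      gcongr
      split_ifs <;> linarith
    rw [Real.norm_eq_abs, abs_mul, abs_abs, abs_of_pos (Real.exp_pos _)]
    calc _ ≤ Real.exp (-c*z) * (2 * Real.exp (-(1/2)*(z-L*ρ))) := by gcongr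
      _ = 2 * (Real.exp (-c*z) * Real.exp (-(1/2)*(z-L*ρ))) := by ring
      _ = 2 * (Real.exp (L*ρ/2) * Real.exp (-(c+1/2)*z)) := by
          rw [← Real.exp_add, ← Real.exp_add]; congr 2; ring
      _ = _ := by ring
      _ ≤ _ := le_rfl

lemma aux_Qmeas {K : ℝ → ℝ → ℝ} {γ a K0 δ ρ : ℝ} (hK : KernelHyp K γ a K0 δ)
    {h : ℝ → ℝ} (hm : Measurable h) : StronglyMeasurable (Qfun K a ρ h) := by
  have hc := hK.2.2.1
  have hk : Continuous (fun t : ℝ => K (Real.exp t) 1) := by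
    have := hc.comp_continuous (f := fun t : ℝ => (Real.exp t, (1:ℝ))) (by fun_prop)
      (fun t => ⟨Real.exp_pos t, one_pos (α := ℝ)⟩)
    exact this
  have hF : Measurable (fun p : ℝ × ℝ =>
      Real.exp (a/ρ*(p.1-p.2)) * K (Real.exp ((p.1-p.2)/ρ)) 1 * h p.2) := by
    have : Continuous (fun p : ℝ × ℝ => K (Real.exp ((p.1-p.2)/ρ)) 1) :=
      hk.comp (by fun_prop : Continuous (fun p : ℝ × ℝ => (p.1-p.2)/ρ))
    exact ((by fun_prop : Measurable (fun p : ℝ × ℝ => Real.exp (a/ρ*(p.1-p.2)))).mul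
      this.measurable).mul (hm.comp measurable_snd)
  exact hF.stronglyMeasurable.integral_prod_right (ν := volume)

lemma aux_Qbound {K : ℝ → ℝ → ℝ} {γ a K0 δ m L ρ : ℝ} (hK : KernelHyp K γ a K0 δ)
    (hρ : 0 < ρ) (ham : a + 1 < m) {h : ℝ → ℝ} (hm : Measurable h)
    (hb : ∀ x : ℝ, |h x| ≤ 2 * Real.exp (omegaFn m L ρ x)) :
    ∃ A B : ℝ, 0 ≤ A ∧ 0 ≤ B ∧ ∀ y, |Qfun K a ρ h y| ≤ A + B * Real.exp ((1+a)/ρ * y) := by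
  have hK0 : 0 < K0 := hK.2.2.2.2.2.2.1
  have ha : 0 < a := by linarith [hK.1, hK.2.1]
  have i0 := aux_int_s7 (c := 0) hρ hm hb le_rfl (by apply div_pos <;> linarith)
  have i1 := aux_int_s7 (c := (1+a)/ρ) hρ hm hb (by positivity) (by gcongr; linarith)
  refine ⟨(1+K0) * ∫ z, Real.exp (-0 * z) * |h z|,
    (1+K0) * ∫ z, Real.exp (-((1+a)/ρ) * z) * |h z|, ?_, ?_, fun y => ?_⟩
  · exact mul_nonneg (by linarith) (integral_nonneg fun z => by positivity)
  · exact mul_nonneg (by linarith) (integral_nonneg fun z => by positivity)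
  · have j0 := i0.const_mul (1+K0)
    have j1 := i1.const_mul ((1+K0) * Real.exp ((1+a)/ρ * y))
    have := norm_integral_le_of_norm_le (μ := volume)
      (f := fun z => Real.exp (a/ρ*(y-z)) * K (Real.exp ((y-z)/ρ)) 1 * h z) (j0.add j1)
      (Eventually.of_forall fun z => ?_)
    · rw [Real.norm_eq_abs] at this
      refine this.trans (le_of_eq ?_)
      simp only [Pi.add_apply]
      rw [integral_add j0 j1, integral_const_mul, integral_const_mul]
      ring
    · have hk := aux_kernel hK (Real.exp ((y-z)/ρ)) (Real.exp_pos _)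
      rw [← Real.exp_mul, ← Real.exp_mul] at hk
      rw [Real.norm_eq_abs, abs_mul, show a/ρ*(y-z) = (y-z)/ρ*a by ring]
      refine (mul_le_mul_of_nonneg_right hk (abs_nonneg _)).trans (le_of_eq ?_)
      simp only [Pi.add_apply]
      have : Real.exp ((y-z)/ρ*(1+a)) = Real.exp ((1+a)/ρ*y) * Real.exp (-((1+a)/ρ)*z) := by
        rw [← Real.exp_add]; congr 1; ring
      rw [this]
      simp
      ring

/-- monotonicity properties related to ψ_ρ (Lemma 4.5, first part). -/
theorem psi_monotonicity
    (K : ℝ → ℝ → ℝ) (γ a K0 δ m L0 ρ0 L ρ : ℝ)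
    (hK : KernelHyp K γ a K0 δ) (hP : ParamHyp a m L0 ρ0)
    (hL : L0 ≤ L) (hρ : ρ ∈ Ioo (0:ℝ) ρ0)
    (h : ℝ → ℝ) (hh : memX a m L ρ h)
    (hQ : ∀ y : ℝ, y < L*ρ → 1/2 ≤ Qfun K a ρ h y) :
    MonotoneOn (fun x => Real.exp (-psiFn K a L ρ h x - (2*m/ρ)*x)) (Iio (-(L*ρ))) ∧
    MonotoneOn (fun x => Real.exp (-(1/2)*psiFn K a L ρ h x - (a/ρ)*x)) (Iio (-(L*ρ))) ∧
    MonotoneOn (fun x => Real.exp (-(1/2)*psiFn K a L ρ h x - (1/ρ)*x)) (Iio (-(L*ρ))) := by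
  obtain ⟨hc, -, -, hb⟩ := hh
  obtain ⟨hm1, hL0, hρ0⟩ := hP
  have hρp : 0 < ρ := hρ.1
  have ha : 0 < a := by linarith [hK.1, hK.2.1]
  have ham : a + 1 < m := lt_of_le_of_lt (le_max_left _ _) hm1
  have hm := aux_meas hc
  have haL : Real.log (4*m) ≤ a * L := by
    have h1 : (1/a) * Real.log (4*m) ≤ L := by linarith
    have h2 := mul_le_mul_of_nonneg_left h1 ha.le
    have h3 : a * ((1/a) * Real.log (4*m)) = Real.log (4*m) := by field_simp
    linarith
  have hLp : 0 < L := by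
    have : 0 < Real.log (4*m) := Real.log_pos (by linarith)
    have h2 : 0 < a * L := by linarith
    exact pos_of_mul_pos_right h2 ha.le
  have he : 4*m ≤ Real.exp (a*L) := by
    rw [← Real.exp_log (show 0 < 4*m by linarith)]
    exact Real.exp_le_exp.2 haL
  obtain ⟨A, B, hA, hB, hAB⟩ := aux_Qbound hK hρp ham hm hb
  have hI : ∀ x, IntegrableOn (fun y => Real.exp (-(a/ρ)*y) * Qfun K a ρ h y) (Ioo x (L*ρ)) := by
    intro x
    have hcont : Continuous (fun y => Real.exp (-(a/ρ)*y) * (A + B * Real.exp ((1+a)/ρ * y))) := by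
      fun_prop
    have h0 : IntegrableOn (fun y => Real.exp (-(a/ρ)*y) * (A + B * Real.exp ((1+a)/ρ * y)))
        (Ioo x (L*ρ)) :=
      (hcont.integrableOn_Icc (a := x) (b := L*ρ)).mono_set Ioo_subset_Icc_self
    have hM : StronglyMeasurable (fun y => Real.exp (-(a/ρ)*y) * Qfun K a ρ h y) :=
      (by fun_prop : Continuous (fun y => Real.exp (-(a/ρ)*y))).stronglyMeasurable.mul
        (aux_Qmeas hK hm)
    refine h0.mono' hM.aestronglyMeasurable (Eventually.of_forall fun y => ?_)
    rw [Real.norm_eq_abs, abs_mul, abs_of_pos (Real.exp_pos _)]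
    exact mul_le_mul_of_nonneg_left (hAB y) (Real.exp_pos _).le
  have key : ∀ x ∈ Iio (-(L*ρ)), ∀ y ∈ Iio (-(L*ρ)), x ≤ y →
      psiFn K a L ρ h y + 2*m/ρ*(y-x) ≤ psiFn K a L ρ h x := by
    intro x hx y hy hxy
    have hy' : y < -(L*ρ) := hy
    have hLρ : 0 < L*ρ := by positivity
    have hsplit : Ioo x (L*ρ) = Ioc x y ∪ Ioo y (L*ρ) := by
      rw [Ioc_union_Ioo_eq_Ioo hxy (by linarith)]
    have hdisj : Disjoint (Ioc x y) (Ioo y (L*ρ)) := by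
      rw [Set.disjoint_left]; intro t h1 h2; exact absurd h2.1 (not_lt.2 h1.2)
    have hI1 : IntegrableOn (fun y => Real.exp (-(a/ρ)*y) * Qfun K a ρ h y) (Ioc x y) :=
      (hI x).mono_set (hsplit ▸ subset_union_left)
    have hlow : (y-x) * (2*m) ≤ ∫ t in Ioc x y, Real.exp (-(a/ρ)*t) * Qfun K a ρ h t := by
      have h1 : ∫ t in Ioc x y, (2*m : ℝ) = (y-x)*(2*m) := by
        simp [hxy]
      rw [← h1]
      refine setIntegral_mono_on (integrableOn_const (by simp)) hI1 measurableSet_Ioc fun t ht => ?_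
      have hq := hQ t (by linarith [ht.2])
      have h2 : a * L ≤ -(a/ρ)*t := by
        have h3 : L * ρ ≤ -t := by linarith [ht.2]
        have h4 := mul_le_mul_of_nonneg_left h3 (div_pos ha hρp).le
        have h5 : a/ρ*(L*ρ) = a * L := by field_simp
        linarith
      have h6 : 4*m ≤ Real.exp (-(a/ρ)*t) := he.trans (Real.exp_le_exp.2 h2)
      nlinarith
    unfold psiFn
    rw [hsplit, setIntegral_union hdisj measurableSet_Ioo hI1 (hI y), mul_add]
    have := mul_le_mul_of_nonneg_left hlow (one_div_pos.2 hρp).le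
    have h7 : 1/ρ*((y-x)*(2*m)) = 2*m/ρ*(y-x) := by ring
    linarith
  have hd : ∀ c, c ≤ m → ∀ x y : ℝ, x ≤ y → c/ρ*(y-x) ≤ m/ρ*(y-x) := by
    intro c hc x y hxy
    exact mul_le_mul_of_nonneg_right (div_le_div_of_nonneg_right hc hρp.le) (by linarith)
  have h2m : ∀ t : ℝ, 2*m/ρ*t = 2*(m/ρ*t) := fun t => by ring
  refine ⟨fun x hx y hy hxy => ?_, fun x hx y hy hxy => ?_, fun x hx y hy hxy => ?_⟩
  · have := key x hx y hy hxy
    refine Real.exp_le_exp.2 ?_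
    linarith
  · have h1 := key x hx y hy hxy
    have h2 := hd a (by linarith) x y hxy
    rw [h2m] at h1
    refine Real.exp_le_exp.2 ?_
    linarith
  · have h1 := key x hx y hy hxy
    have h2 := hd 1 (by linarith) x y hxy
    rw [h2m] at h1
    refine Real.exp_le_exp.2 ?_
    linarith
end
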